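/- Let ζ be an extremal number and ε > 0. Then the inequality |ζ − α| ≤ H(α)^{−4−ε} has only finitely many solutions in real algebraic numbers α of degree exactly three. -/

import Mathlib

open Polynomial

/-- Height of an integer polynomial: the maximum absolute value of its coefficients. -/
noncomputable def polyH (P : Polynomial ℤ) : ℝ :=
  (((P.support.sup fun i => (P.coeff i).natAbs) : ℕ) : ℝ)

/-- Evaluation of an integer polynomial at a real number. -/
noncomputable def pev (ζ : ℝ) (P : Polynomial ℤ) : ℝ := Polynomial.aeval ζ P

/-- Set of exponents η such that for arbitrarily large X the system
    H(P) ≤ X, 0 < |P(ζ)| ≤ X^(−η) has a solution of degree at most n. -/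
def wSet (n : ℕ) (ζ : ℝ) : Set ℝ :=
  {η | ∀ X₀ : ℝ, ∃ X : ℝ, X₀ ≤ X ∧ ∃ P : Polynomial ℤ,
    P.natDegree ≤ n ∧ polyH P ≤ X ∧ 0 < |pev ζ P| ∧ |pev ζ P| ≤ X ^ (-η)}

/-- The exponent w_n(ζ). -/
noncomputable def wExp (n : ℕ) (ζ : ℝ) : ℝ := sSup (wSet n ζ)

/-- Set of exponents η such that for all sufficiently large X the system
    H(P) ≤ X, 0 < |P(ζ)| ≤ X^(−η) has a solution of degree at most n. -/
def whSet (n : ℕ) (ζ : ℝ) : Set ℝ :=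
  {η | ∃ X₀ : ℝ, ∀ X : ℝ, X₀ ≤ X → ∃ P : Polynomial ℤ,
    P.natDegree ≤ n ∧ polyH P ≤ X ∧ 0 < |pev ζ P| ∧ |pev ζ P| ≤ X ^ (-η)}

/-- The uniform exponent ŵ_n(ζ). -/
noncomputable def whExp (n : ℕ) (ζ : ℝ) : ℝ := sSup (whSet n ζ)

/-- Set of exponents η such that for arbitrarily large X the system
    |x| ≤ X, max_{1≤i≤n} |ζ^i x − y_i| ≤ X^(−η) has a nonzero integer solution. -/
def lamSet (n : ℕ) (ζ : ℝ) : Set ℝ :=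
  {η | ∀ X₀ : ℝ, ∃ X : ℝ, X₀ ≤ X ∧ ∃ x : ℤ, ∃ y : Fin n → ℤ,
    (x ≠ 0 ∨ y ≠ 0) ∧ ((|x| : ℤ) : ℝ) ≤ X ∧
    ∀ i : Fin n, |ζ ^ ((i : ℕ) + 1) * (x : ℝ) - (y i : ℝ)| ≤ X ^ (-η)}

/-- The exponent λ_n(ζ). -/
noncomputable def lamExp (n : ℕ) (ζ : ℝ) : ℝ := sSup (lamSet n ζ)

/-- Set of exponents η such that for all sufficiently large X the system
    |x| ≤ X, max_{1≤i≤n} |ζ^i x − y_i| ≤ X^(−η) has a nonzero integer solution. -/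
def lamhSet (n : ℕ) (ζ : ℝ) : Set ℝ :=
  {η | ∃ X₀ : ℝ, ∀ X : ℝ, X₀ ≤ X → ∃ x : ℤ, ∃ y : Fin n → ℤ,
    (x ≠ 0 ∨ y ≠ 0) ∧ ((|x| : ℤ) : ℝ) ≤ X ∧
    ∀ i : Fin n, |ζ ^ ((i : ℕ) + 1) * (x : ℝ) - (y i : ℝ)| ≤ X ^ (-η)}

/-- The uniform exponent λ̂_n(ζ). -/
noncomputable def lamhExp (n : ℕ) (ζ : ℝ) : ℝ := sSup (lamhSet n ζ)

/-- Set of exponents η such that for arbitrarily large X the polynomial system has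
    at least j linearly independent solutions of degree at most n. -/
def wSetJ (n j : ℕ) (ζ : ℝ) : Set ℝ :=
  {η | ∀ X₀ : ℝ, ∃ X : ℝ, X₀ ≤ X ∧ ∃ P : Fin j → Polynomial ℤ,
    LinearIndependent ℤ P ∧ ∀ i : Fin j,
      (P i).natDegree ≤ n ∧ polyH (P i) ≤ X ∧ 0 < |pev ζ (P i)| ∧ |pev ζ (P i)| ≤ X ^ (-η)}

/-- The exponent w_{n,j}(ζ). -/
noncomputable def wExpJ (n j : ℕ) (ζ : ℝ) : ℝ := sSup (wSetJ n j ζ)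

/-- Set of exponents η such that for all sufficiently large X the polynomial system has
    at least j linearly independent solutions of degree at most n. -/
def whSetJ (n j : ℕ) (ζ : ℝ) : Set ℝ :=
  {η | ∃ X₀ : ℝ, ∀ X : ℝ, X₀ ≤ X → ∃ P : Fin j → Polynomial ℤ,
    LinearIndependent ℤ P ∧ ∀ i : Fin j,
      (P i).natDegree ≤ n ∧ polyH (P i) ≤ X ∧ 0 < |pev ζ (P i)| ∧ |pev ζ (P i)| ≤ X ^ (-η)}

/-- The uniform exponent ŵ_{n,j}(ζ). -/
noncomputable def whExpJ (n j : ℕ) (ζ : ℝ) : ℝ := sSup (whSetJ n j ζ)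

/-- Set of exponents η such that for arbitrarily large X the simultaneous approximation
    system has at least j linearly independent integer vector solutions. -/
def lamSetJ (n j : ℕ) (ζ : ℝ) : Set ℝ :=
  {η | ∀ X₀ : ℝ, ∃ X : ℝ, X₀ ≤ X ∧ ∃ v : Fin j → (Fin (n + 1) → ℤ),
    LinearIndependent ℤ v ∧ ∀ i : Fin j,
      ((|v i 0| : ℤ) : ℝ) ≤ X ∧
      ∀ t : Fin n, |ζ ^ ((t : ℕ) + 1) * ((v i 0 : ℤ) : ℝ) - ((v i t.succ : ℤ) : ℝ)| ≤ X ^ (-η)}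

/-- The exponent λ_{n,j}(ζ). -/
noncomputable def lamExpJ (n j : ℕ) (ζ : ℝ) : ℝ := sSup (lamSetJ n j ζ)

/-- Set of exponents η such that for all sufficiently large X the simultaneous approximation
    system has at least j linearly independent integer vector solutions. -/
def lamhSetJ (n j : ℕ) (ζ : ℝ) : Set ℝ :=
  {η | ∃ X₀ : ℝ, ∀ X : ℝ, X₀ ≤ X → ∃ v : Fin j → (Fin (n + 1) → ℤ),
    LinearIndependent ℤ v ∧ ∀ i : Fin j,
      ((|v i 0| : ℤ) : ℝ) ≤ X ∧
      ∀ t : Fin n, |ζ ^ ((t : ℕ) + 1) * ((v i 0 : ℤ) : ℝ) - ((v i t.succ : ℤ) : ℝ)| ≤ X ^ (-η)}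

/-- The uniform exponent λ̂_{n,j}(ζ). -/
noncomputable def lamhExpJ (n j : ℕ) (ζ : ℝ) : ℝ := sSup (lamhSetJ n j ζ)

/-- An extremal number: a real transcendental number with ŵ₂(ζ) = (3+√5)/2. -/
def IsExtremal (ζ : ℝ) : Prop :=
  Transcendental ℚ ζ ∧ whExp 2 ζ = (3 + Real.sqrt 5) / 2

open Real

/-- The value at `ζ` of the polynomial of degree at most two with coefficient vector `v`. -/
noncomputable def quadEval (ζ : ℝ) (v : Fin 3 → ℤ) : ℝ := v 0 + v 1 * ζ + v 2 * ζ ^ 2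

/-- The maximum of the absolute values of the coordinates. -/
def vecHeight (v : Fin 3 → ℤ) : ℕ := max (v 0).natAbs (max (v 1).natAbs (v 2).natAbs)

/-- The logarithmic form of `ŵ₂(ζ) ≥ φ²`. -/
def UniformQuad (ζ : ℝ) : Prop :=
  ∀ η < goldenRatio + 1, ∃ x₀ : ℝ, ∀ x ≥ x₀, ∃ v : Fin 3 → ℤ, 0 < |quadEval ζ v| ∧
    (∀ i, |(v i : ℝ)| ≤ exp x) ∧ |quadEval ζ v| ≤ exp (-(η * x))

lemma goldenRatio_bounds : 1.618 < goldenRatio ∧ goldenRatio < 1.6181 := by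
  have h5 : (Real.sqrt 5) ^ 2 = 5 := Real.sq_sqrt (by norm_num)
  have h0 := Real.sqrt_nonneg 5
  unfold goldenRatio
  constructor <;> nlinarith

lemma abs_coord_le_vecHeight (v : Fin 3 → ℤ) (i : Fin 3) : |(v i : ℝ)| ≤ vecHeight v := by
  have h : (v i).natAbs ≤ vecHeight v := by
    unfold vecHeight
    fin_cases i <;> simp
  calc |(v i : ℝ)| = ((v i).natAbs : ℝ) := by rw [Nat.cast_natAbs, Int.cast_abs]
    _ ≤ _ := by exact_mod_cast h

lemma vecHeight_le_of_forall {v : Fin 3 → ℤ} {X : ℝ} (h : ∀ i, |(v i : ℝ)| ≤ X) :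
    (vecHeight v : ℝ) ≤ X := by
  have h' : ∀ i, ((v i).natAbs : ℝ) ≤ X := fun i => by
    rw [Nat.cast_natAbs, Int.cast_abs]; exact h i
  unfold vecHeight
  push_cast
  exact max_le (h' 0) (max_le (h' 1) (h' 2))

lemma one_le_vecHeight {ζ : ℝ} {v : Fin 3 → ℤ} (h : 0 < |quadEval ζ v|) : 1 ≤ vecHeight v := by
  by_contra hc
  have h0 : ∀ i, v i = 0 := fun i => by
    have := abs_coord_le_vecHeight v i
    have h1 : vecHeight v = 0 := by omega
    rw [h1] at this
    simpa using this
  simp [quadEval, h0] at h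

lemma abs_coeff_le_polyH (P : Polynomial ℤ) (i : ℕ) : |(P.coeff i : ℝ)| ≤ polyH P := by
  have h : (P.coeff i).natAbs ≤ P.support.sup fun i => (P.coeff i).natAbs := by
    by_cases hi : i ∈ P.support
    · exact Finset.le_sup (f := fun i => (P.coeff i).natAbs) hi
    · simp [Polynomial.notMem_support_iff.mp hi]
  calc |(P.coeff i : ℝ)| = ((P.coeff i).natAbs : ℝ) := by rw [Nat.cast_natAbs, Int.cast_abs]
    _ ≤ _ := by unfold polyH; exact_mod_cast h

lemma pev_eq_quadEval {ζ : ℝ} {P : Polynomial ℤ} (h : P.natDegree ≤ 2) :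
    pev ζ P = quadEval ζ (fun i => P.coeff i) := by
  unfold pev quadEval
  rw [Polynomial.aeval_eq_sum_range' (n := 3) (by omega)]
  simp [Finset.sum_range_succ]

lemma IsExtremal.uniformQuad {ζ : ℝ} (hζ : IsExtremal ζ) : UniformQuad ζ := by
  intro η hη
  have hs : η < sSup (whSet 2 ζ) := by
    have : whExp 2 ζ = goldenRatio + 1 := by rw [hζ.2]; unfold goldenRatio; ring
    rw [whExp] at this; rwa [this]
  have hne : (whSet 2 ζ).Nonempty := by
    by_contra hc
    rw [Set.not_nonempty_iff_eq_empty] at hc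
    have h2 := hζ.2
    rw [whExp, hc, Real.sSup_empty] at h2
    have := Real.sqrt_nonneg 5
    linarith
  obtain ⟨η', ⟨X₀, hX⟩, hlt⟩ := exists_lt_of_lt_csSup hne hs
  refine ⟨max 0 X₀, fun x hx => ?_⟩
  have hx0 : 0 ≤ x := le_trans (le_max_left _ _) hx
  obtain ⟨P, hd, hH, hp, hle⟩ := hX (exp x) (by
    have := add_one_le_exp x
    have := le_trans (le_max_right 0 X₀) hx
    linarith)
  rw [pev_eq_quadEval hd] at hp hle
  refine ⟨_, hp, fun i => (abs_coeff_le_polyH P i).trans hH, hle.trans ?_⟩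
  rw [← exp_mul, exp_le_exp]
  nlinarith

/-- Successive quadratic polynomials of minimal height. -/
structure IsMinimalSeq (ζ : ℝ) (q : ℕ → Fin 3 → ℤ) : Prop where
  pos : ∀ n, 0 < |quadEval ζ (q n)|
  anti : ∀ n, |quadEval ζ (q (n + 1))| < |quadEval ζ (q n)|
  mono : Monotone fun n => vecHeight (q n)
  minimal : ∀ n v, 0 < |quadEval ζ v| → |quadEval ζ v| < |quadEval ζ (q n)| →
    vecHeight (q (n + 1)) ≤ vecHeight v

lemma UniformQuad.exists_small {ζ : ℝ} (h : UniformQuad ζ) {r : ℝ} (hr : 0 < r) :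
    ∃ v : Fin 3 → ℤ, 0 < |quadEval ζ v| ∧ |quadEval ζ v| < r := by
  obtain ⟨x₀, hx⟩ := h 1 (by have := goldenRatio_bounds; linarith)
  obtain ⟨v, h1, -, h3⟩ := hx (max x₀ (-(log r) + 1)) (le_max_left _ _)
  refine ⟨v, h1, h3.trans_lt ?_⟩
  rw [← lt_log_iff_exp_lt hr]
  have := le_max_right x₀ (-(log r) + 1)
  linarith

lemma UniformQuad.exists_minimalSeq {ζ : ℝ} (h : UniformQuad ζ) :
    ∃ q, IsMinimalSeq ζ q := by
  have step : ∀ v : {v : Fin 3 → ℤ // 0 < |quadEval ζ v|},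
      ∃ w : {v : Fin 3 → ℤ // 0 < |quadEval ζ v|}, |quadEval ζ w.1| < |quadEval ζ v.1| ∧
        ∀ w', 0 < |quadEval ζ w'| → |quadEval ζ w'| < |quadEval ζ v.1| →
          vecHeight w.1 ≤ vecHeight w' := by
    intro v
    let S : Set (Fin 3 → ℤ) := {w | 0 < |quadEval ζ w| ∧ |quadEval ζ w| < |quadEval ζ v.1|}
    have hS : S.Nonempty := h.exists_small v.2
    obtain ⟨w, hw, hmin⟩ := (measure vecHeight).wf.has_min S hS
    exact ⟨⟨w, hw.1⟩, hw.2, fun w' h1 h2 => not_lt.mp (hmin w' ⟨h1, h2⟩)⟩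
  choose f hf1 hf2 using step
  let base : {v : Fin 3 → ℤ // 0 < |quadEval ζ v|} := ⟨![1, 0, 0], by simp [quadEval]⟩
  let s : ℕ → {v : Fin 3 → ℤ // 0 < |quadEval ζ v|} := fun n => f^[n] base
  have hs : ∀ n, s (n + 1) = f (s n) := fun n => Function.iterate_succ_apply' f n base
  have hanti : ∀ n, |quadEval ζ (s (n + 1)).1| < |quadEval ζ (s n).1| := fun n => by
    rw [hs]; exact hf1 _
  have hmin : ∀ n v, 0 < |quadEval ζ v| → |quadEval ζ v| < |quadEval ζ (s n).1| →
      vecHeight (s (n + 1)).1 ≤ vecHeight v := fun n v => by rw [hs]; exact hf2 _ v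
  refine ⟨fun n => (s n).1, fun n => (s n).2, hanti, monotone_nat_of_le_succ fun n => ?_, hmin⟩
  cases n with
  | zero =>
    refine le_trans ?_ (one_le_vecHeight (s 1).2)
    simp [s, base, vecHeight]
  | succ k => exact hmin k _ (s (k + 2)).2 ((hanti (k + 1)).trans (hanti k))

lemma finite_vecHeight_le (M : ℕ) : {v : Fin 3 → ℤ | vecHeight v ≤ M}.Finite := by
  refine (Set.finite_Icc (fun _ => -(M : ℤ)) (fun _ : Fin 3 => (M : ℤ))).subset fun v hv => ?_
  have hi : ∀ i, |v i| ≤ (M : ℤ) := fun i => by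
    have h1 := abs_coord_le_vecHeight v i
    have h2 : (vecHeight v : ℝ) ≤ M := by exact_mod_cast hv
    exact_mod_cast h1.trans h2
  exact ⟨fun i => (abs_le.mp (hi i)).1, fun i => (abs_le.mp (hi i)).2⟩

namespace IsMinimalSeq

variable {ζ : ℝ} {q : ℕ → Fin 3 → ℤ}

lemma strictAnti (h : IsMinimalSeq ζ q) : StrictAnti fun n => |quadEval ζ (q n)| :=
  strictAnti_nat_of_succ_lt h.anti

lemma one_le (h : IsMinimalSeq ζ q) (n : ℕ) : (1 : ℝ) ≤ vecHeight (q n) := by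
  exact_mod_cast one_le_vecHeight (h.pos n)

lemma exists_log_ge (h : IsMinimalSeq ζ q) (x : ℝ) :
    ∃ N, ∀ n ≥ N, x ≤ log (vecHeight (q n)) := by
  obtain ⟨M, hM⟩ := exists_nat_ge (exp x)
  have : ∃ N, M ≤ vecHeight (q N) := by
    by_contra! hc
    have hinj : Function.Injective q := fun i j hij => h.strictAnti.injective (by simp [hij])
    exact (Set.infinite_range_of_injective hinj)
      ((finite_vecHeight_le M).subset (by rintro _ ⟨n, rfl⟩; exact (hc n).le))
  obtain ⟨N, hN⟩ := this
  refine ⟨N, fun n hn => ?_⟩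
  have h1 : M ≤ vecHeight (q n) := hN.trans (h.mono hn)
  have h2 : (M : ℝ) ≤ vecHeight (q n) := by exact_mod_cast h1
  rw [le_log_iff_exp_le (by linarith [h.one_le n])]
  linarith

lemma coord_le (h : IsMinimalSeq ζ q) (n : ℕ) (i : Fin 3) :
    |(q n i : ℝ)| ≤ exp (log (vecHeight (q n))) := by
  rw [exp_log (by linarith [h.one_le n])]
  exact abs_coord_le_vecHeight _ _

lemma log_mono (h : IsMinimalSeq ζ q) {m n : ℕ} (hmn : m ≤ n) :
    log (vecHeight (q m)) ≤ log (vecHeight (q n)) :=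
  log_le_log (by linarith [h.one_le m]) (by exact_mod_cast h.mono hmn)

lemma decay (h : IsMinimalSeq ζ q) (hu : UniformQuad ζ) {η : ℝ} (hη : η < goldenRatio + 1) :
    ∃ N, ∀ n ≥ N, |quadEval ζ (q n)| ≤ exp (-(η * log (vecHeight (q (n + 1))))) := by
  obtain ⟨η', h1, h2⟩ := exists_between hη
  obtain ⟨x₀, hx⟩ := hu η' h2
  obtain ⟨N, hN⟩ := h.exists_log_ge (max (x₀ + 1) (η' / (η' - η)))
  refine ⟨N, fun n hn => ?_⟩
  have hl := hN (n + 1) (by omega)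
  set l := log (vecHeight (q (n + 1))) with hldef
  have hl1 : x₀ + 1 ≤ l := (le_max_left _ _).trans hl
  have hl2 : η' / (η' - η) ≤ l := (le_max_right _ _).trans hl
  obtain ⟨v, hv1, hv2, hv3⟩ := hx (l - 1) (by linarith)
  have hv4 : (vecHeight v : ℝ) < vecHeight (q (n + 1)) := by
    refine (vecHeight_le_of_forall hv2).trans_lt ?_
    rw [← lt_log_iff_exp_lt (by linarith [h.one_le (n + 1)])]
    linarith
  have hv5 : |quadEval ζ (q n)| ≤ |quadEval ζ v| := by
    by_contra! hc
    have h3 := h.minimal n v hv1 hc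
    have h4 : (vecHeight (q (n + 1)) : ℝ) ≤ vecHeight v := by exact_mod_cast h3
    linarith
  refine (hv5.trans hv3).trans (exp_le_exp.mpr ?_)
  rw [div_le_iff₀ (by linarith)] at hl2
  nlinarith

end IsMinimalSeq

/-- The linear forms `q * ζ - p` are bounded below by a constant times `|q| ^ (-w)`. -/
def LinearLower (ζ w : ℝ) : Prop :=
  ∃ C : ℝ, ∀ p q : ℤ, q ≠ 0 → exp (-(C + w * log |(q : ℝ)|)) ≤ |q * ζ - p|

lemma one_le_abs_intCast {n : ℤ} (hn : n ≠ 0) : (1 : ℝ) ≤ |(n : ℝ)| := by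
  exact_mod_cast Int.one_le_abs hn

lemma log_abs_intCast_nonneg {n : ℤ} (hn : n ≠ 0) : 0 ≤ log |(n : ℝ)| :=
  log_nonneg (one_le_abs_intCast hn)

lemma exp_log_abs_intCast {n : ℤ} (hn : n ≠ 0) : exp (log |(n : ℝ)|) = |(n : ℝ)| :=
  exp_log (by linarith [one_le_abs_intCast hn])

lemma neg_log_le_of_one_le_mul_exp {K s : ℝ} (hK : 0 < K) (h : 1 ≤ K * exp s) :
    -log K ≤ s := by
  have := log_le_log one_pos h
  rw [log_mul hK.ne' (exp_pos s).ne', log_exp, log_one] at this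
  linarith

lemma neg_log_le_or_of_one_le {K s t : ℝ} (hK : 0 < K) (h : 1 ≤ K * (exp s + exp t)) :
    -log (2 * K) ≤ s ∨ -log (2 * K) ≤ t := by
  rcases le_total s t with hst | hst
  · right
    apply neg_log_le_of_one_le_mul_exp (by positivity)
    have := exp_le_exp.mpr hst
    nlinarith
  · left
    apply neg_log_le_of_one_le_mul_exp (by positivity)
    have := exp_le_exp.mpr hst
    nlinarith

lemma exists_pos_le_abs_mul_sub {ζ : ℝ} (hζ : Irrational ζ) (M : ℕ) :
    ∃ c > 0, ∀ p q : ℤ, q ≠ 0 → |(q : ℝ)| ≤ M → c ≤ |q * ζ - p| := by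
  let S : Set ℤ := {q | q ≠ 0 ∧ |(q : ℝ)| ≤ M}
  have hS : S.Finite := by
    refine (Set.finite_Icc (-(M : ℤ)) M).subset fun q hq => ?_
    have : |q| ≤ (M : ℤ) := by exact_mod_cast hq.2
    exact abs_le.mp this
  rcases S.eq_empty_or_nonempty with he | hne
  · refine ⟨1, one_pos, fun p q hq hM => ?_⟩
    have : q ∈ S := ⟨hq, hM⟩
    simp [he] at this
  obtain ⟨r, hr, hmin⟩ := Set.exists_min_image S (fun q => |q * ζ - round (q * ζ)|) hS hne
  refine ⟨|r * ζ - round (r * ζ)|, ?_, fun p q hq hM => (hmin q ⟨hq, hM⟩).trans (round_le _ _)⟩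
  rw [gt_iff_lt, abs_pos, sub_ne_zero]
  exact ((hζ.intCast_mul hr.1).ne_int _)

lemma LinearLower.of_coprime_eventually {ζ w : ℝ} (hζ : Irrational ζ) (hw : 0 ≤ w)
    (h : ∃ Λ : ℝ, ∀ p q : ℤ, q ≠ 0 → IsCoprime p q → Λ ≤ log |(q : ℝ)| →
      exp (-(w * log |(q : ℝ)|)) ≤ |q * ζ - p|) : LinearLower ζ w := by
  obtain ⟨Λ, hΛ⟩ := h
  obtain ⟨M, hM⟩ := exists_nat_ge (exp Λ)
  obtain ⟨c, hc, hcM⟩ := exists_pos_le_abs_mul_sub hζ M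
  have key : ∀ p q : ℤ, q ≠ 0 → IsCoprime p q →
      exp (-(max 0 (-log c) + w * log |(q : ℝ)|)) ≤ |q * ζ - p| := by
    intro p q hq hpq
    have h0 := mul_nonneg hw (log_abs_intCast_nonneg hq)
    by_cases hl : Λ ≤ log |(q : ℝ)|
    · refine (exp_le_exp.mpr ?_).trans (hΛ p q hq hpq hl)
      linarith [le_max_left 0 (-log c)]
    · refine le_trans ?_ (hcM p q hq ?_)
      · rw [← le_log_iff_exp_le hc]
        linarith [le_max_right 0 (-log c)]
      · have := exp_lt_exp.mpr (not_le.mp hl)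
        rw [exp_log_abs_intCast hq] at this
        linarith
  refine ⟨max 0 (-log c), fun p q hq => ?_⟩
  have hg : (Int.gcd p q : ℤ) ≠ 0 := by
    simp [Int.gcd_eq_zero_iff, hq]
  obtain ⟨p', hp'⟩ := Int.gcd_dvd_left p q
  obtain ⟨q', hq'⟩ := Int.gcd_dvd_right p q
  have hco : IsCoprime p' q' := by
    rw [Int.isCoprime_iff_gcd_eq_one]
    have h1 := Int.gcd_mul_left (Int.gcd p q) p' q'
    rw [← hp', ← hq', Int.natAbs_natCast] at h1
    have h2 : 0 < Int.gcd p q := by omega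
    exact (Nat.eq_of_mul_eq_mul_left h2 (by omega)).symm
  set g : ℤ := (Int.gcd p q : ℤ)
  have hq0 : q' ≠ 0 := by rintro rfl; simp at hq'; exact hq hq'
  have hgR := one_le_abs_intCast hg
  have h1 : |(q : ℝ) * ζ - p| = |(g : ℝ)| * |q' * ζ - p'| := by
    rw [hp', hq', ← abs_mul]; push_cast; ring_nf
  have h2 : |(q' : ℝ)| ≤ |(q : ℝ)| := by
    rw [hq']; push_cast; rw [abs_mul]
    nlinarith [abs_nonneg (q' : ℝ)]
  have h3 : log |(q' : ℝ)| ≤ log |(q : ℝ)| :=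
    log_le_log (by linarith [one_le_abs_intCast hq0]) h2
  calc exp (-(max 0 (-log c) + w * log |(q : ℝ)|))
      ≤ exp (-(max 0 (-log c) + w * log |(q' : ℝ)|)) := by
        rw [exp_le_exp]; nlinarith
    _ ≤ |q' * ζ - p'| := key p' q' hq0 hco
    _ ≤ |(q : ℝ) * ζ - p| := by rw [h1]; nlinarith [abs_nonneg ((q' : ℝ) * ζ - p')]

lemma homogenized_ne_zero {p q : ℤ} (hq : q ≠ 0) (hpq : IsCoprime p q) {v : Fin 3 → ℤ}
    (hv : v ≠ 0) (hlt : ∀ i, |v i| < |q|) :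
    q ^ 2 * v 0 + q * p * v 1 + p ^ 2 * v 2 ≠ 0 := by
  intro h
  have hpq' : IsCoprime q p := hpq.symm
  have h2 : v 2 = 0 := by
    apply Int.eq_zero_of_abs_lt_dvd (m := |q|) _ (hlt 2)
    rw [abs_dvd]
    refine (hpq'.pow_right (n := 2)).dvd_of_dvd_mul_left ⟨-(q * v 0 + p * v 1), ?_⟩
    linear_combination h
  have h3 : q * v 0 + p * v 1 = 0 := by
    apply mul_left_cancel₀ hq
    rw [h2] at h
    linear_combination h
  have h1 : v 1 = 0 := by
    apply Int.eq_zero_of_abs_lt_dvd (m := |q|) _ (hlt 1)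
    rw [abs_dvd]
    refine hpq'.dvd_of_dvd_mul_left ⟨-v 0, ?_⟩
    linear_combination h3
  have h0 : v 0 = 0 := by
    rw [h1] at h3
    simpa [hq] using h3
  exact hv (by ext i; fin_cases i <;> simp [h0, h1, h2])

lemma UniformQuad.linearLower {ζ : ℝ} (h : UniformQuad ζ) (hζ : Irrational ζ) :
    LinearLower ζ 1.8 := by
  apply LinearLower.of_coprime_eventually hζ (by norm_num)
  obtain ⟨x₀, hx⟩ := h 2.6 (by have := goldenRatio_bounds; linarith)
  set K : ℝ := 2 * |ζ| + 2 with hK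
  have hKpos : 0 < K := by positivity
  refine ⟨max 1 (max (x₀ / 0.78) ((log (2 * K) + 1) / 0.02)), fun p q hq hpq hl => ?_⟩
  set l := log |(q : ℝ)| with hldef
  have hl1 : 1 ≤ l := (le_max_left _ _).trans hl
  have hl2 : x₀ / 0.78 ≤ l := ((le_max_left _ _).trans (le_max_right _ _)).trans hl
  have hl3 : (log (2 * K) + 1) / 0.02 ≤ l :=
    ((le_max_right _ _).trans (le_max_right _ _)).trans hl
  rw [div_le_iff₀ (by norm_num)] at hl2 hl3
  have hqe : exp l = |(q : ℝ)| := exp_log_abs_intCast hq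
  obtain ⟨v, hv1, hv2, hv3⟩ := hx (0.78 * l) (by linarith)
  by_contra! hlt
  have hn := homogenized_ne_zero hq hpq (v := v) (by rintro rfl; simp [quadEval] at hv1)
    (fun i => by
      have h1 := (hv2 i).trans_lt (exp_lt_exp.mpr (by linarith : 0.78 * l < l))
      rw [hqe] at h1
      exact_mod_cast h1)
  have hn1 := one_le_abs_intCast hn
  have hid : ((q ^ 2 * v 0 + q * p * v 1 + p ^ 2 * v 2 : ℤ) : ℝ)
      = q ^ 2 * quadEval ζ v - (q * ζ - p) * (q * v 1 + v 2 * (q * ζ + p)) := by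
    unfold quadEval; push_cast; ring
  have hd1 : |(q : ℝ) * ζ - p| ≤ 1 := by
    refine hlt.le.trans ?_
    rw [exp_le_one_iff]; linarith
  have hq1 := one_le_abs_intCast hq
  have hp : |(p : ℝ)| ≤ |(q : ℝ)| * (|ζ| + 1) := by
    have : (p : ℝ) = q * ζ - (q * ζ - p) := by ring
    rw [this]
    refine (abs_sub _ _).trans ?_
    rw [abs_mul]
    nlinarith
  have hb : |(q : ℝ) * v 1 + v 2 * (q * ζ + p)| ≤ K * (exp l * exp (0.78 * l)) := by
    refine (abs_add_le _ _).trans ?_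
    rw [abs_mul, abs_mul, hqe]
    have h1 : |(q : ℝ) * ζ + p| ≤ |(q : ℝ)| * (2 * |ζ| + 1) := by
      refine (abs_add_le _ _).trans ?_
      rw [abs_mul]; linarith
    calc |(q : ℝ)| * |(v 1 : ℝ)| + |(v 2 : ℝ)| * |(q : ℝ) * ζ + p|
        ≤ |(q : ℝ)| * exp (0.78 * l) + exp (0.78 * l) * (|(q : ℝ)| * (2 * |ζ| + 1)) := by
          gcongr
          · exact hv2 1
          · exact hv2 2
      _ = _ := by rw [hK]; ring
  have hmain : 1 ≤ K * (exp (2 * l - 2.6 * (0.78 * l)) + exp (-(1.8 * l) + l + 0.78 * l)) := by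
    refine hn1.trans ?_
    rw [hid]
    refine (abs_sub _ _).trans ?_
    rw [abs_mul, abs_mul, abs_pow, ← hqe]
    have e1 : exp (2 * l - 2.6 * (0.78 * l)) = exp l ^ 2 * exp (-(2.6 * (0.78 * l))) := by
      rw [← exp_nat_mul, ← exp_add]; push_cast; ring_nf
    have e2 : exp (-(1.8 * l) + l + 0.78 * l)
        = exp (-(1.8 * l)) * (exp l * exp (0.78 * l)) := by
      rw [← exp_add, ← exp_add]; ring_nf
    rw [e1, e2, mul_add K]
    have hK1 : 1 ≤ K := by rw [hK]; linarith [abs_nonneg ζ]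
    refine add_le_add ?_ ?_
    · calc exp l ^ 2 * |quadEval ζ v| ≤ exp l ^ 2 * exp (-(2.6 * (0.78 * l))) := by gcongr
        _ ≤ _ := le_mul_of_one_le_left (by positivity) hK1
    · calc _ ≤ exp (-(1.8 * l)) * (K * (exp l * exp (0.78 * l))) := by
            gcongr
        _ = _ := by ring
  rcases neg_log_le_or_of_one_le hKpos hmain with h1 | h1 <;> linarith

/-- The discriminant-like form whose value at a cross product is a resultant. -/
def conicForm (z : Fin 3 → ℤ) : ℤ := z 0 * z 2 - z 1 ^ 2

lemma conicForm_ne_zero {ζ : ℝ} (h : LinearLower ζ 1.8) (K : ℝ) :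
    ∃ x₀ : ℝ, ∀ x ≥ x₀, ∀ z : Fin 3 → ℤ, z ≠ 0 → |(z 0 : ℝ)| ≤ exp (2 * x + K) →
      |z 1 - z 0 * ζ| ≤ exp (-(1.6 * x) + K) → |z 2 - z 0 * ζ ^ 2| ≤ exp (-(1.6 * x) + K) →
      conicForm z ≠ 0 := by
  obtain ⟨C, hC⟩ := h
  refine ⟨max ((C + 1.4 * K) / 0.8 + 1) (K / 1.6 + 1), fun x hx z hz h0 h1 h2 hD => ?_⟩
  have hx1 : (C + 1.4 * K) / 0.8 + 1 ≤ x := (le_max_left _ _).trans hx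
  have hx2 : K / 1.6 + 1 ≤ x := (le_max_right _ _).trans hx
  have hx1' : C + 1.4 * K < 0.8 * x := by
    have : (C + 1.4 * K) / 0.8 * 0.8 = C + 1.4 * K := by field_simp
    linarith
  have hx2' : K < 1.6 * x := by
    have : K / 1.6 * 1.6 = K := by field_simp
    linarith
  unfold conicForm at hD
  by_cases hz0 : z 0 = 0
  · have hz1 : z 1 = 0 := by
      rw [hz0] at hD
      have : z 1 ^ 2 = 0 := by linarith
      simpa using this
    have hz2 : z 2 = 0 := by
      by_contra hc
      have h3 := one_le_abs_intCast hc
      have h4 : exp (-(1.6 * x) + K) < 1 := by rw [exp_lt_one_iff]; linarith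
      simp [hz0] at h2
      linarith
    exact hz (by ext i; fin_cases i <;> simp [hz0, hz1, hz2])
  have hg : (Int.gcd (z 0) (z 1) : ℤ) ≠ 0 := by
    simp [Int.gcd_eq_zero_iff, hz0]
  obtain ⟨q, hq⟩ := Int.gcd_dvd_left (z 0) (z 1)
  obtain ⟨p, hp⟩ := Int.gcd_dvd_right (z 0) (z 1)
  have hco : IsCoprime q p := by
    rw [Int.isCoprime_iff_gcd_eq_one]
    have h1 := Int.gcd_mul_left (Int.gcd (z 0) (z 1)) q p
    rw [← hp, ← hq, Int.natAbs_natCast] at h1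
    have h2 : 0 < Int.gcd (z 0) (z 1) := by omega
    exact (Nat.eq_of_mul_eq_mul_left h2 (by omega)).symm
  set g : ℤ := (Int.gcd (z 0) (z 1) : ℤ)
  have hq0 : q ≠ 0 := by rintro rfl; simp at hq; exact hz0 hq
  have hdvd : q ∣ g := by
    refine (hco.pow_right (n := 2)).dvd_of_dvd_mul_right ⟨z 2, ?_⟩
    apply mul_left_cancel₀ hg
    rw [hq, hp] at hD
    linear_combination -hD
  obtain ⟨m, hm⟩ := hdvd
  have hm0 : m ≠ 0 := by rintro rfl; simp at hm; exact hg hm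
  have hqe := exp_log_abs_intCast hq0
  set l := log |(q : ℝ)|
  have hl0 : 0 ≤ l := log_abs_intCast_nonneg hq0
  have hm1 := one_le_abs_intCast hm0
  have hl : 2 * l ≤ 2 * x + K := by
    rw [← exp_le_exp]
    refine le_trans ?_ h0
    have : exp (2 * l) = |(q : ℝ)| * |(q : ℝ)| := by rw [two_mul, exp_add, hqe]
    rw [this, hq, hm]
    push_cast
    rw [abs_mul, abs_mul]
    have := mul_nonneg (abs_nonneg (q : ℝ)) (abs_nonneg (q : ℝ))
    nlinarith
  have hb := hC p q hq0
  have hlow : exp (l + -(C + 1.8 * l)) ≤ |z 1 - z 0 * ζ| := by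
    have : |z 1 - z 0 * ζ| = |(g : ℝ)| * |q * ζ - p| := by
      rw [hp, hq, ← abs_mul, ← abs_neg]; push_cast; ring_nf
    rw [this, exp_add, hqe]
    refine mul_le_mul ?_ hb (exp_pos _).le (abs_nonneg _)
    rw [hm]; push_cast; rw [abs_mul]
    nlinarith [abs_nonneg (q : ℝ)]
  have := exp_le_exp.mp (hlow.trans h1)
  linarith

open Matrix in
lemma crossProduct_coords (u v : Fin 3 → ℤ) :
    crossProduct u v 0 = u 1 * v 2 - u 2 * v 1 ∧ crossProduct u v 1 = u 2 * v 0 - u 0 * v 2 ∧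
      crossProduct u v 2 = u 0 * v 1 - u 1 * v 0 := by
  simp [cross_apply]

/-- The pairing of a vector with a linear form. -/
def dot3 (x u : Fin 3 → ℤ) : ℤ := x 0 * u 0 + x 1 * u 1 + x 2 * u 2

lemma exists_abs_coord_eq_vecHeight (v : Fin 3 → ℤ) : ∃ i, |(v i : ℝ)| = vecHeight v := by
  have : ∃ i, (v i).natAbs = vecHeight v := by
    unfold vecHeight
    rcases max_choice (v 0).natAbs (max (v 1).natAbs (v 2).natAbs) with h | h
    · exact ⟨0, h.symm⟩
    · rw [h]
      rcases max_choice (v 1).natAbs (v 2).natAbs with h | h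
      · exact ⟨1, h.symm⟩
      · exact ⟨2, h.symm⟩
  obtain ⟨i, hi⟩ := this
  exact ⟨i, by rw [← hi, Nat.cast_natAbs, Int.cast_abs]⟩

lemma crossProduct_ne_zero {ζ : ℝ} {u v : Fin 3 → ℤ} (hv : 0 < |quadEval ζ v|)
    (hlt : |quadEval ζ v| < |quadEval ζ u|) (hle : vecHeight u ≤ vecHeight v) :
    crossProduct u v ≠ 0 := by
  intro h
  obtain ⟨c0, c1, c2⟩ := crossProduct_coords u v
  simp only [h, Pi.zero_apply] at c0 c1 c2
  have r0 : (u 1 * v 2 - u 2 * v 1 : ℝ) = 0 := by exact_mod_cast c0.symm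
  have r1 : (u 2 * v 0 - u 0 * v 2 : ℝ) = 0 := by exact_mod_cast c1.symm
  have r2 : (u 0 * v 1 - u 1 * v 0 : ℝ) = 0 := by exact_mod_cast c2.symm
  have key : ∀ i, quadEval ζ u * v i = quadEval ζ v * u i := by
    intro i
    unfold quadEval
    fin_cases i
    · simp only [Fin.zero_eta]; linear_combination (-ζ) * r2 + ζ ^ 2 * r1
    · simp only [Fin.mk_one]; linear_combination r2 - ζ ^ 2 * r0
    · simp only [Fin.reduceFinMk]; linear_combination -r1 + ζ * r0
  obtain ⟨i, hi⟩ := exists_abs_coord_eq_vecHeight v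
  have h1 : |quadEval ζ u| * |(v i : ℝ)| = |quadEval ζ v| * |(u i : ℝ)| := by
    rw [← abs_mul, ← abs_mul, key]
  have h2 := abs_coord_le_vecHeight u i
  have h3 : (vecHeight u : ℝ) ≤ vecHeight v := by exact_mod_cast hle
  have h4 : (1 : ℝ) ≤ vecHeight v := by exact_mod_cast one_le_vecHeight hv
  rw [hi] at h1
  nlinarith

/-- Vectors with vanishing two by two minors. -/
def Parallel (x z : Fin 3 → ℤ) : Prop := ∀ i j, x i * z j = x j * z i

lemma parallel_crossProduct {x u v : Fin 3 → ℤ} (hu : dot3 x u = 0) (hv : dot3 x v = 0) :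
    Parallel x (crossProduct u v) := by
  obtain ⟨c0, c1, c2⟩ := crossProduct_coords u v
  unfold dot3 at hu hv
  have h01 : x 0 * crossProduct u v 1 = x 1 * crossProduct u v 0 := by
    rw [c0, c1]; linear_combination u 2 * hv - v 2 * hu
  have h02 : x 0 * crossProduct u v 2 = x 2 * crossProduct u v 0 := by
    rw [c0, c2]; linear_combination v 1 * hu - u 1 * hv
  have h12 : x 1 * crossProduct u v 2 = x 2 * crossProduct u v 1 := by
    rw [c1, c2]; linear_combination u 0 * hv - v 0 * hu
  intro i j
  fin_cases i <;> fin_cases j <;> simp <;> first | assumption | (symm; assumption)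

lemma Parallel.exists_common {x z : Fin 3 → ℤ} (h : Parallel x z) (hx : x ≠ 0) (hz : z ≠ 0) :
    ∃ (y : Fin 3 → ℤ) (m n : ℤ), m ≠ 0 ∧ n ≠ 0 ∧ (∀ i, x i = m * y i) ∧ ∀ i, z i = n * y i := by
  obtain ⟨g, hg⟩ := (IsPrincipalIdealRing.principal (Ideal.span (Set.range x))).principal
  have hgx : ∀ i, ∃ a, x i = g * a := fun i => by
    have : x i ∈ Ideal.span {g} := by
      rw [Ideal.span, ← hg]; exact Submodule.subset_span ⟨i, rfl⟩
    exact Ideal.mem_span_singleton.mp this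
  choose y hy using hgx
  have hg0 : g ≠ 0 := by
    rintro rfl
    exact hx (by ext i; simp [hy i])
  have hmem : g ∈ Submodule.span ℤ (Set.range x) := by
    change g ∈ Ideal.span (Set.range x)
    rw [hg]; exact Submodule.mem_span_singleton_self g
  obtain ⟨s, hs⟩ := (Submodule.mem_span_range_iff_exists_fun ℤ).mp hmem
  have hsum : s 0 * y 0 + s 1 * y 1 + s 2 * y 2 = 1 := by
    apply mul_left_cancel₀ hg0
    simp only [Fin.sum_univ_three, smul_eq_mul, hy] at hs
    linear_combination hs
  have hyz : ∀ i j, y i * z j = y j * z i := fun i j => by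
    apply mul_left_cancel₀ hg0
    have := h i j
    rw [hy i, hy j] at this
    linear_combination this
  have hzn : ∀ j, z j = (s 0 * z 0 + s 1 * z 1 + s 2 * z 2) * y j := fun j => by
    linear_combination s 0 * hyz 0 j + s 1 * hyz 1 j + s 2 * hyz 2 j - z j * hsum
  refine ⟨y, g, s 0 * z 0 + s 1 * z 1 + s 2 * z 2, hg0, fun hn => hz ?_, hy, hzn⟩
  ext j
  rw [hzn, hn]; simp

lemma Parallel.conicForm_ne_zero {x z : Fin 3 → ℤ} (h : Parallel x z) (hz : z ≠ 0)
    (hD : conicForm x ≠ 0) : conicForm z ≠ 0 := by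
  obtain ⟨i, hi⟩ := Function.ne_iff.mp hz
  rw [Pi.zero_apply] at hi
  intro hc
  apply hD
  have : z i ^ 2 * conicForm x = x i ^ 2 * conicForm z := by
    unfold conicForm
    linear_combination (-z i * x 2) * h i 0 - (x i * z 0) * h i 2
      + (x i * z 1 + x 1 * z i) * h i 1
  rw [hc] at this
  simpa [hi] using this

lemma dot3_eq_zero_of_parallel {x z w : Fin 3 → ℤ} (h : Parallel x z) (hz : z ≠ 0)
    (hw : dot3 z w = 0) : dot3 x w = 0 := by
  obtain ⟨i, hi⟩ := Function.ne_iff.mp hz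
  apply mul_left_cancel₀ hi
  unfold dot3 at *
  linear_combination x i * hw - w 0 * h i 0 - w 1 * h i 1 - w 2 * h i 2

lemma dot3_crossProduct_left (u v : Fin 3 → ℤ) : dot3 (crossProduct u v) u = 0 := by
  obtain ⟨c0, c1, c2⟩ := crossProduct_coords u v
  unfold dot3; rw [c0, c1, c2]; ring

lemma dot3_crossProduct_right (u v : Fin 3 → ℤ) : dot3 (crossProduct u v) v = 0 := by
  obtain ⟨c0, c1, c2⟩ := crossProduct_coords u v
  unfold dot3; rw [c0, c1, c2]; ring

lemma abs_mul_sub_mul_le {a b c d A B C D : ℝ} (ha : |a| ≤ A) (hb : |b| ≤ B) (hc : |c| ≤ C)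
    (hd : |d| ≤ D) : |a * b - c * d| ≤ A * B + C * D := by
  refine (abs_sub _ _).trans ?_
  rw [abs_mul, abs_mul]
  have := (abs_nonneg a).trans ha
  have := (abs_nonneg c).trans hc
  gcongr

lemma crossProduct_coord_le {u v : Fin 3 → ℤ} {A B : ℝ} (hu : ∀ i, |(u i : ℝ)| ≤ A)
    (hv : ∀ i, |(v i : ℝ)| ≤ B) (i : Fin 3) : |(crossProduct u v i : ℝ)| ≤ 2 * (A * B) := by
  obtain ⟨c0, c1, c2⟩ := crossProduct_coords u v
  have key : ∀ i j k l, |(u i * v j - u k * v l : ℝ)| ≤ 2 * (A * B) := fun i j k l =>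
    (abs_mul_sub_mul_le (hu i) (hv j) (hu k) (hv l)).trans_eq (by ring)
  fin_cases i
  · simp only [Fin.zero_eta, c0]; push_cast; exact key _ _ _ _
  · simp only [Fin.mk_one, c1]; push_cast; exact key _ _ _ _
  · simp only [Fin.reduceFinMk, c2]; push_cast; exact key _ _ _ _

lemma crossProduct_error_le {ζ : ℝ} {u v : Fin 3 → ℤ} {A B E F : ℝ} (hu : ∀ i, |(u i : ℝ)| ≤ A)
    (hv : ∀ i, |(v i : ℝ)| ≤ B) (hE : |quadEval ζ u| ≤ E) (hF : |quadEval ζ v| ≤ F) :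
    |crossProduct u v 1 - crossProduct u v 0 * ζ| ≤ A * F + B * E ∧
      |crossProduct u v 2 - crossProduct u v 0 * ζ ^ 2| ≤ A * F + B * E := by
  obtain ⟨c0, c1, c2⟩ := crossProduct_coords u v
  rw [c0, c1, c2]
  constructor
  · have : ((u 2 * v 0 - u 0 * v 2 : ℤ) : ℝ) - ((u 1 * v 2 - u 2 * v 1 : ℤ) : ℝ) * ζ
        = u 2 * quadEval ζ v - v 2 * quadEval ζ u := by
      unfold quadEval; push_cast; ring
    rw [this]
    exact abs_mul_sub_mul_le (hu 2) hF (hv 2) hE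
  · have : ((u 0 * v 1 - u 1 * v 0 : ℤ) : ℝ) - ((u 1 * v 2 - u 2 * v 1 : ℤ) : ℝ) * ζ ^ 2
        = v 1 * quadEval ζ u - u 1 * quadEval ζ v := by
      unfold quadEval; push_cast; ring
    rw [this]
    exact (abs_mul_sub_mul_le (hv 1) hE (hu 1) hF).trans_eq (by ring)

lemma abs_dot3_crossProduct_le {ζ : ℝ} {u v w : Fin 3 → ℤ} {a b c e : ℝ} (hab : a ≤ b)
    (hbc : b ≤ c) (hu : ∀ i, |(u i : ℝ)| ≤ exp a) (hv : ∀ i, |(v i : ℝ)| ≤ exp b)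
    (hw : ∀ i, |(w i : ℝ)| ≤ exp c) (hE : |quadEval ζ u| ≤ exp e)
    (hF : |quadEval ζ v| ≤ exp e) (hG : |quadEval ζ w| ≤ exp e) :
    |(dot3 (crossProduct u v) w : ℝ)| ≤ 6 * exp (e + b + c) := by
  obtain ⟨c0, c1, c2⟩ := crossProduct_coords u v
  have hid : (dot3 (crossProduct u v) w : ℝ)
      = quadEval ζ u * (v 1 * w 2 - v 2 * w 1) - quadEval ζ v * (u 1 * w 2 - u 2 * w 1)
        + quadEval ζ w * (u 1 * v 2 - u 2 * v 1) := by
    unfold dot3 quadEval; rw [c0, c1, c2]; push_cast; ring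
  have h1 := abs_mul_sub_mul_le (hv 1) (hw 2) (hv 2) (hw 1)
  have h2 := abs_mul_sub_mul_le (hu 1) (hw 2) (hu 2) (hw 1)
  have h3 := abs_mul_sub_mul_le (hu 1) (hv 2) (hu 2) (hv 1)
  have eab := exp_le_exp.mpr hab
  have ebc := exp_le_exp.mpr hbc
  rw [hid, exp_add, exp_add]
  calc _ ≤ |quadEval ζ u * (v 1 * w 2 - v 2 * w 1) - quadEval ζ v * (u 1 * w 2 - u 2 * w 1)|
        + |quadEval ζ w * (u 1 * v 2 - u 2 * v 1)| := abs_add_le _ _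
    _ ≤ (exp e * (exp b * exp c + exp b * exp c) + exp e * (exp a * exp c + exp a * exp c))
        + exp e * (exp a * exp b + exp a * exp b) := by
      gcongr
      · exact abs_mul_sub_mul_le hE h1 hF h2
      · rw [abs_mul]; gcongr
    _ ≤ (exp e * (exp b * exp c + exp b * exp c) + exp e * (exp b * exp c + exp b * exp c))
        + exp e * (exp b * exp c + exp b * exp c) := by
      gcongr
    _ = _ := by ring

lemma abs_conicForm_le {ζ Y V : ℝ} {z : Fin 3 → ℤ} (h0 : |(z 0 : ℝ)| ≤ Y)
    (h01 : |(z 1 : ℝ)| ≤ Y) (h1 : |z 1 - z 0 * ζ| ≤ V) (h2 : |z 2 - z 0 * ζ ^ 2| ≤ V) :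
    |(conicForm z : ℝ)| ≤ (2 + |ζ|) * (Y * V) := by
  have hid : (conicForm z : ℝ)
      = z 0 * (z 2 - z 0 * ζ ^ 2) - (z 1 + z 0 * ζ) * (z 1 - z 0 * ζ) := by
    unfold conicForm; push_cast; ring
  rw [hid]
  have h3 : |(z 1 : ℝ) + z 0 * ζ| ≤ Y + Y * |ζ| := by
    refine (abs_add_le _ _).trans ?_
    rw [abs_mul]; gcongr
  exact (abs_mul_sub_mul_le h0 h2 h3 h1).trans_eq (by ring)

/-- Pairs of coprime quadratic polynomials whose heights and values at `ζ` follow the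
pattern of an extremal number, stated in logarithmic form. -/
def HasExtremalPairs (ζ : ℝ) : Prop :=
  ∀ δ > 0, ∃ x₀ : ℝ, ∀ x ≥ x₀, ∃ (u v : Fin 3 → ℤ) (a b : ℝ), x ≤ b ∧
    b ≤ (goldenRatio + δ) * x ∧ |a - (goldenRatio - 1) * b| ≤ δ * b ∧
    (∀ i, |(u i : ℝ)| ≤ exp a) ∧ (∀ i, |(v i : ℝ)| ≤ exp b) ∧
    |quadEval ζ u| ≤ exp (-((goldenRatio + 1 - δ) * b)) ∧
    |quadEval ζ v| ≤ exp (-((2 * goldenRatio + 1 - δ) * b)) ∧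
    conicForm (crossProduct u v) ≠ 0

/-- The exponents of an extremal pair, derived from the growth inequalities for four
heights `exp a`, `exp a'`, `exp b`, `exp b'` of a minimal sequence. -/
lemma extremal_exponents {δ d a a' b b' c x : ℝ} (hd : 0 < d) (hdδ : 20 * d ≤ δ)
    (hd1 : d ≤ 0.01) (ha0 : 0 < a) (hc : c ≤ d * a) (hax : a ≤ x) (hxb : x < b) (hab : a' ≤ b)
    (h1 : (goldenRatio - d) * a ≤ a' + c) (h2 : (goldenRatio - d) * b ≤ b' + c)
    (h3 : (goldenRatio - d) * b ≤ a + a' + c) :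
    b ≤ (goldenRatio + δ) * x ∧ |a - (goldenRatio - 1) * b| ≤ δ * b ∧
      (goldenRatio + 1 - δ) * b ≤ (goldenRatio + 1 - d) * a' ∧
      (2 * goldenRatio + 1 - δ) * b ≤ (goldenRatio + 1 - d) * b' := by
  have hg := goldenRatio_sq
  obtain ⟨hg1, hg2⟩ := goldenRatio_bounds
  set g := goldenRatio
  have hab' : a ≤ b := by linarith
  have hb0 : 0 < b := by linarith
  have hda : 0 < d * a := by positivity
  have hdb : 0 < d * b := by positivity
  have hdab : d * a ≤ d * b := by gcongr
  have h4 : (g - 1) * b ≤ a + d * b + d * a := by linarith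
  have h5 : b ≤ 1.8 * a := by nlinarith
  have h6 : g * a ≤ b + 2 * (d * a) := by linarith
  have h7 : a ≤ (g - 1) * b + 2 * (d * b) := by
    have : (g - 1) * (g * a) ≤ (g - 1) * (b + 2 * (d * a)) := by gcongr; linarith
    have h8 : (g - 1) * (g * a) = a := by linear_combination a * hg
    have h9 : (g - 1) * (2 * (d * a)) ≤ 2 * (d * b) := by nlinarith
    linarith
  have h10 : b - 4 * (d * b) ≤ a' := by linarith
  have h11 : (g - 2 * d) * b ≤ b' := by linarith
  refine ⟨?_, ?_, ?_, ?_⟩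
  · have h8 : g * ((g - 1) * b) = b := by linear_combination b * hg
    have h9 : g * ((g - 1) * b) ≤ g * (a + d * b + d * a) := by gcongr
    have h12 : d * b ≤ 1.8 * (d * a) := by nlinarith
    have h13 : g * (d * b + d * a) ≤ 20 * (d * a) := by nlinarith
    have h14 : 20 * (d * a) ≤ δ * a := by nlinarith
    have h15 : (g + δ) * a ≤ (g + δ) * x := by gcongr; linarith
    linarith
  · rw [abs_le]
    have : 20 * (d * b) ≤ δ * b := by nlinarith
    constructor <;> linarith
  · have h8 : (g + 1 - d) * (b - 4 * (d * b)) ≤ (g + 1 - d) * a' := by gcongr; linarith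
    have h9 : 20 * (d * b) ≤ δ * b := by nlinarith
    have h12 : (g + 1 - d) * (4 * (d * b)) ≤ 12 * (d * b) := by nlinarith
    linarith
  · have h8 : (g + 1 - d) * ((g - 2 * d) * b) ≤ (g + 1 - d) * b' := by gcongr; linarith
    have h9 : 20 * (d * b) ≤ δ * b := by nlinarith
    have h12 : (g + 1 - d) * ((g - 2 * d) * b) = (2 * g + 1) * b - (3 * g + 2 - 2 * d) * (d * b) := by
      linear_combination b * hg
    have h13 : (3 * g + 2 - 2 * d) * (d * b) ≤ 20 * (d * b) := by gcongr; linarith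
    linarith

namespace IsMinimalSeq

variable {ζ : ℝ} {q : ℕ → Fin 3 → ℤ}

lemma cross_succ_ne_zero (h : IsMinimalSeq ζ q) {m n : ℕ} (hmn : m < n) :
    crossProduct (q m) (q n) ≠ 0 :=
  crossProduct_ne_zero (h.pos n) (h.strictAnti hmn) (h.mono hmn.le)

lemma growth (h : IsMinimalSeq ζ q) {n : ℕ} {η : ℝ}
    (hdec : |quadEval ζ (q n)| ≤ exp (-(η * log (vecHeight (q (n + 1))))))
    (hdet : dot3 (crossProduct (q n) (q (n + 1))) (q (n + 2)) ≠ 0) :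
    (η - 1) * log (vecHeight (q (n + 1))) ≤ log (vecHeight (q (n + 2))) + log 6 := by
  have h1 := abs_dot3_crossProduct_le (h.log_mono (Nat.le_succ n))
    (h.log_mono (Nat.le_succ (n + 1))) (h.coord_le n) (h.coord_le (n + 1)) (h.coord_le (n + 2))
    hdec ((h.anti n).le.trans hdec) (((h.anti (n + 1)).trans (h.anti n)).le.trans hdec)
  have h2 := neg_log_le_of_one_le_mul_exp (by norm_num) ((one_le_abs_intCast hdet).trans h1)
  simp only [Nat.succ_eq_add_one, add_assoc, Nat.reduceAdd] at h2 ⊢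
  linarith

lemma cross_error_le (h : IsMinimalSeq ζ q) {n : ℕ} {η : ℝ}
    (hdec : |quadEval ζ (q n)| ≤ exp (-(η * log (vecHeight (q (n + 1)))))) :
    |crossProduct (q n) (q (n + 1)) 1 - crossProduct (q n) (q (n + 1)) 0 * ζ|
        ≤ 2 * exp (-((η - 1) * log (vecHeight (q (n + 1))))) ∧
      |crossProduct (q n) (q (n + 1)) 2 - crossProduct (q n) (q (n + 1)) 0 * ζ ^ 2|
        ≤ 2 * exp (-((η - 1) * log (vecHeight (q (n + 1))))) := by
  have h1 := crossProduct_error_le (h.coord_le n) (h.coord_le (n + 1)) hdec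
    ((h.anti n).le.trans hdec)
  have h2 := exp_le_exp.mpr (h.log_mono (Nat.le_succ n))
  have h3 : exp (log (vecHeight (q n))) * exp (-(η * log (vecHeight (q (n + 1)))))
      + exp (log (vecHeight (q (n + 1)))) * exp (-(η * log (vecHeight (q (n + 1)))))
      ≤ 2 * exp (-((η - 1) * log (vecHeight (q (n + 1))))) := by
    have h4 : exp (-((η - 1) * log (vecHeight (q (n + 1)))))
        = exp (log (vecHeight (q (n + 1)))) * exp (-(η * log (vecHeight (q (n + 1))))) := by
      rw [← exp_add]; ring_nf
    rw [h4]
    have := mul_le_mul_of_nonneg_right h2 (exp_pos (-(η * log (vecHeight (q (n + 1)))))).le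
    simp only [Nat.succ_eq_add_one] at this
    linarith
  exact ⟨h1.1.trans h3, h1.2.trans h3⟩

lemma exit_bound (h : IsMinimalSeq ζ q) {j n : ℕ} {η : ℝ}
    (hdec : |quadEval ζ (q n)| ≤ exp (-(η * log (vecHeight (q (n + 1))))))
    (hD : conicForm (crossProduct (q j) (q (j + 1))) ≠ 0)
    (hn : dot3 (crossProduct (q j) (q (j + 1))) (q n) = 0)
    (hn1 : dot3 (crossProduct (q j) (q (j + 1))) (q (n + 1)) = 0) :
    (η - 1) * log (vecHeight (q (n + 1))) ≤ log (vecHeight (q j)) + log (vecHeight (q (j + 1)))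
      + log (4 * (2 + |ζ|)) := by
  obtain ⟨y, m, k, hm, hk, hxy, hzy⟩ := (parallel_crossProduct hn hn1).exists_common
    (h.cross_succ_ne_zero (Nat.lt_succ_self j)) (h.cross_succ_ne_zero (Nat.lt_succ_self n))
  have hy : ∀ i, |(y i : ℝ)|
      ≤ 2 * (exp (log (vecHeight (q j))) * exp (log (vecHeight (q (j + 1))))) := fun i => by
    refine le_trans ?_ (crossProduct_coord_le (h.coord_le j) (h.coord_le (j + 1)) i)
    rw [hxy i]; push_cast; rw [abs_mul]
    nlinarith [one_le_abs_intCast hm, abs_nonneg (y i : ℝ)]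
  obtain ⟨e1, e2⟩ := h.cross_error_le hdec
  rw [hzy 0, hzy 1] at e1
  rw [hzy 0, hzy 2] at e2
  have key : ∀ (s : ℤ) (t : ℝ) (V : ℝ), |((k * s : ℤ) : ℝ) - ((k * y 0 : ℤ) : ℝ) * t| ≤ V →
      |(s : ℝ) - y 0 * t| ≤ V := fun s t V hV => by
    refine le_trans ?_ hV
    have : ((k * s : ℤ) : ℝ) - ((k * y 0 : ℤ) : ℝ) * t = k * (s - y 0 * t) := by
      push_cast; ring
    rw [this, abs_mul]
    nlinarith [one_le_abs_intCast hk, abs_nonneg ((s : ℝ) - y 0 * t)]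
  have hDy : conicForm y ≠ 0 := by
    intro hc
    apply hD
    unfold conicForm at *
    rw [hxy 0, hxy 1, hxy 2]
    linear_combination m ^ 2 * hc
  have h1 := (one_le_abs_intCast hDy).trans
    (abs_conicForm_le (hy 0) (hy 1) (key _ _ _ e1) (key _ _ _ e2))
  have h2 : (2 + |ζ|) * (2 * (exp (log (vecHeight (q j))) * exp (log (vecHeight (q (j + 1)))))
      * (2 * exp (-((η - 1) * log (vecHeight (q (n + 1)))))))
      = 4 * (2 + |ζ|) * exp (log (vecHeight (q j)) + log (vecHeight (q (j + 1)))
        + -((η - 1) * log (vecHeight (q (n + 1))))) := by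
    rw [exp_add, exp_add]; ring
  rw [h2] at h1
  have := neg_log_le_of_one_le_mul_exp (by positivity) h1
  linarith

lemma dot3_eq_zero_of_flat (h : IsMinimalSeq ζ q) {j : ℕ} {i : ℕ} (hji : j ≤ i)
    (hflat : ∀ m, j ≤ m → m < i → dot3 (crossProduct (q m) (q (m + 1))) (q (m + 2)) = 0) :
    dot3 (crossProduct (q j) (q (j + 1))) (q i) = 0 ∧
      dot3 (crossProduct (q j) (q (j + 1))) (q (i + 1)) = 0 := by
  induction i, hji using Nat.le_induction with
  | base => exact ⟨dot3_crossProduct_left _ _, dot3_crossProduct_right _ _⟩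
  | succ i hji ih =>
    obtain ⟨h1, h2⟩ := ih fun m hm hmi => hflat m hm (by omega)
    exact ⟨h2, dot3_eq_zero_of_parallel (parallel_crossProduct h1 h2)
      (h.cross_succ_ne_zero (Nat.lt_succ_self i)) (hflat i hji (Nat.lt_succ_self i))⟩

lemma eventually_conicForm_ne_zero (h : IsMinimalSeq ζ q) (hu : UniformQuad ζ)
    (hL : LinearLower ζ 1.8) :
    ∃ N, ∀ n ≥ N, conicForm (crossProduct (q n) (q (n + 1))) ≠ 0 := by
  obtain ⟨N₁, h1⟩ := h.decay hu (η := 2.6) (by have := goldenRatio_bounds; linarith)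
  obtain ⟨x₀, hx⟩ := conicForm_ne_zero hL (log 2)
  obtain ⟨N₂, h2⟩ := h.exists_log_ge x₀
  refine ⟨max N₁ N₂, fun n hn => ?_⟩
  obtain ⟨e1, e2⟩ := h.cross_error_le (h1 n ((le_max_left _ _).trans hn))
  have hlog : ∀ t : ℝ, exp (t + log 2) = 2 * exp t := fun t => by
    rw [exp_add, exp_log two_pos]; ring
  refine hx (log (vecHeight (q (n + 1)))) (h2 _ (by have := (le_max_right N₁ N₂).trans hn; omega))
    _ (h.cross_succ_ne_zero (Nat.lt_succ_self n)) ?_ ?_ ?_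
  · refine (crossProduct_coord_le (h.coord_le n) (h.coord_le (n + 1)) 0).trans ?_
    rw [hlog, two_mul (log _), exp_add]
    have := exp_le_exp.mpr (h.log_mono (Nat.le_succ n))
    gcongr
  · rw [hlog]; norm_num at e1 ⊢; exact e1
  · rw [hlog]; norm_num at e2 ⊢; exact e2

end IsMinimalSeq

lemma UniformQuad.hasExtremalPairs {ζ : ℝ} (hu : UniformQuad ζ) (hζ : Irrational ζ) :
    HasExtremalPairs ζ := by
  intro δ hδ
  obtain ⟨q, h⟩ := hu.exists_minimalSeq
  set d : ℝ := min (δ / 20) 0.01 with hdd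
  have hd : 0 < d := by positivity
  have hdδ : 20 * d ≤ δ := by have := min_le_left (δ / 20) 0.01; linarith
  have hd1 : d ≤ 0.01 := min_le_right _ _
  set c : ℝ := max (log 6) (log (4 * (2 + |ζ|))) with hcd
  obtain ⟨N₁, hN₁⟩ := h.decay hu (η := goldenRatio + 1 - d) (by linarith)
  obtain ⟨N₂, hN₂⟩ := h.exists_log_ge (max (c / d) 1)
  obtain ⟨N₃, hN₃⟩ := h.eventually_conicForm_ne_zero hu (hu.linearLower hζ)
  set N := max N₁ (max N₂ N₃) with hN
  have hNN₁ : N₁ ≤ N := le_max_left _ _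
  have hNN₂ : N₂ ≤ N := (le_max_left _ _).trans (le_max_right _ _)
  have hNN₃ : N₃ ≤ N := (le_max_right _ _).trans (le_max_right _ _)
  set l : ℕ → ℝ := fun n => log (vecHeight (q n)) with hl
  -- indices where the sequence leaves a plane
  let T : ℕ → Prop := fun n =>
    N + 1 ≤ n ∧ dot3 (crossProduct (q (n - 1)) (q n)) (q (n + 1)) ≠ 0
  have hgrow : ∀ n, T n → (goldenRatio - d) * l n ≤ l (n + 1) + c := by
    rintro n ⟨hn, hdet⟩
    obtain ⟨m, rfl⟩ : ∃ m, n = m + 1 := ⟨n - 1, by omega⟩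
    have := h.growth (hN₁ m (by omega)) hdet
    have := le_max_left (log 6) (log (4 * (2 + |ζ|)))
    simp only [hl]
    linarith
  have hexit : ∀ j n, N ≤ j → j ≤ n →
      (∀ m, j < m → m ≤ n → ¬ T m) → (goldenRatio - d) * l (n + 1) ≤ l j + l (j + 1) + c ∧
      dot3 (crossProduct (q j) (q (j + 1))) (q (n + 1)) = 0 := by
    intro j n hj hjn hT
    obtain ⟨h1, h2⟩ := h.dot3_eq_zero_of_flat hjn fun m hjm hmn => by
      have := hT (m + 1) (by omega) (by omega)
      by_contra hc
      exact this ⟨by omega, hc⟩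
    have := h.exit_bound (hN₁ n (by omega)) (hN₃ j (by omega)) h1 h2
    have := le_max_right (log 6) (log (4 * (2 + |ζ|)))
    refine ⟨?_, h2⟩
    simp only [hl]
    linarith
  have hinf : ∀ j ≥ N, ∃ n > j, T n := by
    intro j hj
    by_contra! hc
    obtain ⟨M, hM⟩ := h.exists_log_ge (l j + l (j + 1) + c + 1)
    have h1 := (hexit j (max j M) hj (le_max_left _ _) fun m hm _ => hc m hm).1
    have h2 := hM (max j M + 1) (by have := le_max_right j M; omega)
    have h3 := hN₂ (max j M + 1) (by have := le_max_left j M; omega)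
    have h4 := (le_max_right (c / d) 1).trans h3
    have hg := goldenRatio_bounds.1
    simp only [hl] at h1 h2
    nlinarith
  obtain ⟨j₀, -, hj₀⟩ := hinf N le_rfl
  refine ⟨l j₀, fun x hx => ?_⟩
  have hex : ∃ n, T n ∧ x < l n := by
    obtain ⟨M, hM⟩ := h.exists_log_ge (x + 1)
    obtain ⟨n, hn, hTn⟩ := hinf (max N M) (le_max_left _ _)
    refine ⟨n, hTn, ?_⟩
    have := hM n (by have := le_max_right N M; omega)
    simp only [hl]; linarith
  classical
  set n := Nat.find hex with hnd
  obtain ⟨hTn, hxn⟩ := Nat.find_spec hex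
  have hj₀n : j₀ < n := by
    by_contra! hc
    have : l n ≤ l j₀ := h.log_mono hc
    linarith
  set j := Nat.findGreatest T (n - 1) with hjd
  have hTj : T j := Nat.findGreatest_spec (P := T) (by omega : j₀ ≤ n - 1) hj₀
  have hjn : j < n := by
    have := Nat.findGreatest_le (P := T) (n - 1)
    omega
  have hjx : l j ≤ x := by
    by_contra! hc
    exact Nat.find_min hex hjn ⟨hTj, hc⟩
  have hlarge : max (c / d) 1 ≤ l j := hN₂ j (by have := hTj.1; omega)
  have hl1 : 1 ≤ l j := (le_max_right _ _).trans hlarge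
  have hcj : c ≤ d * l j := by
    have := (le_max_left _ _).trans hlarge
    rw [div_le_iff₀ hd] at this
    linarith
  obtain ⟨m, hm⟩ : ∃ m, n = m + 1 := ⟨n - 1, by omega⟩
  obtain ⟨h3, hdot⟩ := hexit j m (by have := hTj.1; omega) (by omega) fun k hk hkm hTk =>
    Nat.findGreatest_is_greatest hk (by omega) hTk
  rw [← hm] at h3 hdot
  obtain ⟨r1, r2, r3, r4⟩ := extremal_exponents hd hdδ hd1 (by linarith) hcj hjx hxn
    (h.log_mono (by omega : j + 1 ≤ n)) (hgrow j hTj) (hgrow n hTn) h3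
  have hjN : N₃ ≤ j := by have := hTj.1; omega
  refine ⟨q j, q n, l j, l n, hxn.le, r1, r2, h.coord_le j, h.coord_le n,
    (hN₁ j (by have := hTj.1; omega)).trans (exp_le_exp.mpr (neg_le_neg r3)),
    (hN₁ n (by have := hTn.1; omega)).trans (exp_le_exp.mpr (neg_le_neg r4)), ?_⟩
  exact (parallel_crossProduct (dot3_crossProduct_left _ _) hdot).conicForm_ne_zero
    (h.cross_succ_ne_zero hjn) (hN₃ j hjN)

lemma LinearLower.mono {ζ w w' : ℝ} (h : LinearLower ζ w) (hw : w ≤ w') : LinearLower ζ w' := by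
  obtain ⟨C, hC⟩ := h
  refine ⟨C, fun p q hq => le_trans ?_ (hC p q hq)⟩
  have := log_abs_intCast_nonneg hq
  rw [exp_le_exp]
  nlinarith

/-- Coordinate bounds on the cross product of an extremal pair. -/
lemma crossProduct_bounds {ζ a b d : ℝ} {u v : Fin 3 → ℤ} (hb : 0 ≤ b) (hd : d ≤ 0.1)
    (hab : |a - (goldenRatio - 1) * b| ≤ d * b)
    (hu : ∀ i, |(u i : ℝ)| ≤ exp a) (hv : ∀ i, |(v i : ℝ)| ≤ exp b)
    (hE : |quadEval ζ u| ≤ exp (-((goldenRatio + 1 - d) * b)))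
    (hF : |quadEval ζ v| ≤ exp (-((2 * goldenRatio + 1 - d) * b))) :
    |(crossProduct u v 0 : ℝ)| ≤ 2 * exp ((goldenRatio + d) * b) ∧
    |crossProduct u v 1 - crossProduct u v 0 * ζ| ≤ 2 * exp (-((goldenRatio - d) * b)) ∧
    |crossProduct u v 2 - crossProduct u v 0 * ζ ^ 2| ≤ 2 * exp (-((goldenRatio - d) * b)) := by
  have ha := (abs_le.mp hab).2
  have herr : exp a * exp (-((2 * goldenRatio + 1 - d) * b))
      + exp b * exp (-((goldenRatio + 1 - d) * b)) ≤ 2 * exp (-((goldenRatio - d) * b)) := by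
    rw [← exp_add, ← exp_add, two_mul (exp _)]
    apply add_le_add <;> rw [exp_le_exp] <;> nlinarith
  obtain ⟨h1, h2⟩ := crossProduct_error_le hu hv hE hF
  refine ⟨(crossProduct_coord_le hu hv 0).trans ?_, h1.trans herr, h2.trans herr⟩
  rw [← exp_add]
  gcongr
  nlinarith

/-- A rational approximation `p / q` and a vector close to `(1, ζ, ζ ^ 2)` off the conic
together produce a new linear form in `1` and `ζ`. -/
lemma exists_smaller_approximation {ζ Y V : ℝ} {p q : ℤ} {z : Fin 3 → ℤ} (hq : q ≠ 0)
    (hpq : |(q : ℝ) * ζ - p| ≤ 1) (h0 : |(z 0 : ℝ)| ≤ Y) (h1 : |z 1 - z 0 * ζ| ≤ V)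
    (h2 : |z 2 - z 0 * ζ ^ 2| ≤ V) (hD : conicForm z ≠ 0)
    (hV : 2 * (|ζ| + 1) * (|(q : ℝ)| * V) < 1) :
    ∃ r r' : ℤ, r ≠ 0 ∧ |(r : ℝ)| ≤ |(q : ℝ)| * V + Y * |(q : ℝ) * ζ - p| ∧
      |(r : ℝ) * ζ - r'| ≤ 2 * (|ζ| + 1) * (|(q : ℝ)| * V) := by
  have hp : |(p : ℝ)| ≤ |(q : ℝ)| * (|ζ| + 1) := by
    have hq1 := one_le_abs_intCast hq
    have : (p : ℝ) = q * ζ - (q * ζ - p) := by ring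
    rw [this]
    refine (abs_sub _ _).trans ?_
    rw [abs_mul]
    nlinarith
  have hrr' : |((q * z 1 - p * z 0 : ℤ) : ℝ) * ζ - (q * z 2 - p * z 1 : ℤ)|
      ≤ 2 * (|ζ| + 1) * (|(q : ℝ)| * V) := by
    have hid : ((q * z 1 - p * z 0 : ℤ) : ℝ) * ζ - (q * z 2 - p * z 1 : ℤ)
        = q * (ζ * (z 1 - z 0 * ζ) - 1 * (z 2 - z 0 * ζ ^ 2)) - (-p) * (z 1 - z 0 * ζ) := by
      push_cast; ring
    rw [hid]
    have := abs_mul_sub_mul_le (le_refl |ζ|) h1 (abs_one (α := ℝ)).le h2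
    exact (abs_mul_sub_mul_le le_rfl this ((abs_neg (p : ℝ)).trans_le hp) h1).trans_eq (by ring)
  refine ⟨q * z 1 - p * z 0, q * z 2 - p * z 1, fun hr => ?_, ?_, hrr'⟩
  · have hr' : q * z 2 - p * z 1 = 0 := by
      by_contra hc
      rw [hr] at hrr'
      simp only [Int.cast_zero, zero_mul, zero_sub, abs_neg] at hrr'
      linarith [one_le_abs_intCast hc]
    have : q * conicForm z = 0 := by
      unfold conicForm
      linear_combination z 0 * hr' - z 1 * hr
    exact (mul_ne_zero hq hD) this
  · have hid : ((q * z 1 - p * z 0 : ℤ) : ℝ)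
        = q * (z 1 - z 0 * ζ) - (-z 0) * (q * ζ - p) := by
      push_cast; ring
    rw [hid]
    exact abs_mul_sub_mul_le le_rfl h1 ((abs_neg (z 0 : ℝ)).trans_le h0) le_rfl

lemma LinearLower.improve {ζ t δ : ℝ} (h : LinearLower ζ (1 + t)) (hP : HasExtremalPairs ζ)
    (hζ : Irrational ζ) (hδ : 0 < δ) (hδ1 : δ ≤ 0.1) (hδt : δ ≤ t) (ht : t ≤ 0.8) :
    LinearLower ζ (1 + max δ (0.8 * t)) := by
  have hτ := le_max_right δ (0.8 * t)
  set τ := max δ (0.8 * t)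
  apply LinearLower.of_coprime_eventually hζ (by linarith)
  obtain ⟨C, hC⟩ := h
  set d : ℝ := δ / 100 with hd
  obtain ⟨x₀, hx₀⟩ := hP d (by positivity)
  set K : ℝ := 4 * (|ζ| + 1) with hK
  have hKpos : 0 < K := by positivity
  have hK4 : 4 ≤ K := by linarith [abs_nonneg ζ]
  have hlogK : 0 ≤ log K := log_nonneg (by linarith)
  obtain ⟨hg1, hg2⟩ := goldenRatio_bounds
  have hgg := goldenRatio_sq
  refine ⟨max 1 (max (x₀ / 0.6) ((|C| + 3 * log K + 1) / (0.05 * δ))), fun p q hq _ hl => ?_⟩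
  set l := log |(q : ℝ)| with hldef
  have hl1 : 1 ≤ l := (le_max_left _ _).trans hl
  have hl2 : x₀ / 0.6 ≤ l := ((le_max_left _ _).trans (le_max_right _ _)).trans hl
  have hl3 : (|C| + 3 * log K + 1) / (0.05 * δ) ≤ l :=
    ((le_max_right _ _).trans (le_max_right _ _)).trans hl
  rw [div_le_iff₀ (by positivity)] at hl2 hl3
  have hqe : exp l = |(q : ℝ)| := exp_log_abs_intCast hq
  have hxl : 0.6 * l ≤ (1 + δ / 2) * (goldenRatio - 1) * l := by
    gcongr
    have : 0 ≤ δ / 2 * (goldenRatio - 1) := mul_nonneg (by positivity) (by linarith)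
    linarith
  obtain ⟨u, v, a, b, hxb, hbx, hab, hu, hv, hE, hF, hD⟩ :=
    hx₀ ((1 + δ / 2) * (goldenRatio - 1) * l) (by linarith)
  by_contra! hlt
  have hb0 : 0 ≤ b := by linarith
  have hδl : 0 < δ * l := by positivity
  have hgb : (1 + δ / 2) * l ≤ goldenRatio * b := by
    have : (1 + δ / 2) * l = goldenRatio * ((1 + δ / 2) * (goldenRatio - 1) * l) := by
      linear_combination -(1 + δ / 2) * l * hgg
    rw [this]
    gcongr
  have hb1 : b ≤ 1.052 * l := by
    refine hbx.trans ?_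
    have : (goldenRatio + d) * ((1 + δ / 2) * (goldenRatio - 1) * l)
        = ((1 + d * (goldenRatio - 1)) * (1 + δ / 2)) * l := by
      linear_combination (1 + δ / 2) * l * hgg
    rw [this]
    gcongr
    calc (1 + d * (goldenRatio - 1)) * (1 + δ / 2)
        ≤ (1 + 0.001 * 1) * (1 + 0.1 / 2) := by gcongr <;> linarith
      _ ≤ 1.052 := by norm_num
  have hgb2 : goldenRatio * b ≤ 1.71 * l := by
    have := mul_le_mul_of_nonneg_right hg2.le hb0
    linarith
  have hdb : d * b ≤ 0.011 * (δ * l) := by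
    have := mul_le_mul_of_nonneg_left hb1 hδ.le
    rw [hd]; linarith
  obtain ⟨h0, h1, h2⟩ := crossProduct_bounds hb0 (by rw [hd]; linarith) hab hu hv hE hF
  set z := crossProduct u v
  set s : ℝ := l - (goldenRatio - d) * b with hs
  have hsle : s ≤ -(0.4 * (δ * l)) := by rw [hs]; linarith
  have hslog : s + log K < 0 := by linarith [abs_nonneg C]
  have hKs : K * exp s < 1 := by
    rw [← exp_log hKpos, ← exp_add, exp_lt_one_iff]; linarith
  have es : exp s = exp l * exp (-((goldenRatio - d) * b)) := by
    rw [← exp_add, hs]; ring_nf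
  have hτl : 0 ≤ (1 + τ) * l := mul_nonneg (by linarith) (by linarith)
  obtain ⟨r, r', hr0, hrB, hrr'⟩ := exists_smaller_approximation hq
    (hlt.le.trans (exp_le_one_iff.mpr (by linarith))) h0 h1 h2 hD
    (by rw [← hqe]; convert hKs using 1; rw [es, hK]; ring)
  set B : ℝ := (goldenRatio + d) * b - (1 + τ) * l with hB
  replace hrB : |(r : ℝ)| ≤ 2 * exp s + 2 * exp B := by
    refine hrB.trans ?_
    rw [hB, sub_eq_add_neg ((goldenRatio + d) * b), exp_add, es, ← hqe]
    have := mul_le_mul_of_nonneg_left hlt.le (exp_pos ((goldenRatio + d) * b)).le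
    linarith
  replace hrr' : |(r : ℝ) * ζ - r'| ≤ K * exp s := by
    refine hrr'.trans_eq ?_
    rw [es, hK, ← hqe]; ring
  have hrK : log |(r : ℝ)| ≤ log K + B := by
    have h1 := one_le_abs_intCast hr0
    rw [← exp_le_exp, exp_log_abs_intCast hr0, exp_add, exp_log hKpos]
    have h2 := mul_le_mul_of_nonneg_right hK4 (exp_pos s).le
    have h3 := mul_le_mul_of_nonneg_right hK4 (exp_pos B).le
    linarith
  have hfin := (hC r' r hr0).trans hrr'
  rw [← exp_log hKpos, ← exp_add, exp_le_exp] at hfin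
  have ht0 : 0 ≤ t := hδ.le.trans hδt
  have h3 : (1 + t) * log |(r : ℝ)| ≤ (1 + t) * (log K + B) := by
    gcongr
  have h6 : 0.8 * t * l ≤ τ * l := by gcongr
  have h4 : t * B ≤ t * (0.71 * l + 0.011 * (δ * l) - 0.8 * t * l) := by
    gcongr
    rw [hB]; linarith
  have hCa := le_abs_self C
  have h5 : s + B = 2 * (d * b) - τ * l := by rw [hs, hB]; ring
  have h7 : t * (δ * l) ≤ 0.8 * (δ * l) := by gcongr
  have h8 : δ * l ≤ t * l := by gcongr
  have h9 : 0 ≤ t * t * l := by positivity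
  have h10 : t * log K ≤ 1 * log K := by gcongr; linarith
  linarith

lemma HasExtremalPairs.linearLower {ζ δ : ℝ} (hP : HasExtremalPairs ζ) (hζ : Irrational ζ)
    (h : LinearLower ζ 1.8) (hδ : 0 < δ) : LinearLower ζ (1 + δ) := by
  suffices H : ∀ δ > 0, δ ≤ 0.1 → LinearLower ζ (1 + δ) from
    (H (min δ 0.1) (by positivity) (min_le_right _ _)).mono (by gcongr; exact min_le_left _ _)
  intro δ hδ hδ1
  have key : ∀ n : ℕ, LinearLower ζ (1 + max δ (0.8 ^ n * 0.8)) := by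
    intro n
    induction n with
    | zero => exact h.mono (by norm_num [max_def]; split_ifs <;> linarith)
    | succ n ih =>
      have h1 : (0.8 : ℝ) ^ n ≤ 1 := pow_le_one₀ (by norm_num) (by norm_num)
      refine (ih.improve hP hζ hδ hδ1 (le_max_left _ _)
        (max_le (by linarith) (by linarith))).mono ?_
      refine add_le_add le_rfl (max_le (le_max_left _ _) ?_)
      rcases max_choice δ ((0.8 : ℝ) ^ n * 0.8) with h | h <;> rw [h]
      · exact le_trans (by linarith) (le_max_left _ _)
      · exact le_trans (by rw [pow_succ]; linarith) (le_max_right _ _)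
  obtain ⟨n, hn⟩ := exists_pow_lt_of_lt_one hδ (by norm_num : (0.8 : ℝ) < 1)
  exact (key n).mono (by gcongr; exact max_le le_rfl (by linarith))

/-- The determinant of the last three columns of three rows of length four. -/
def minor4 {R : Type*} [CommRing R] (a b c : Fin 4 → R) : R :=
  a 1 * (b 2 * c 3 - b 3 * c 2) - a 2 * (b 1 * c 3 - b 3 * c 1)
    + a 3 * (b 1 * c 2 - b 2 * c 1)

/-- The determinant of four rows of length four, expanded along the first column. -/
def det4 {R : Type*} [CommRing R] (a b c d : Fin 4 → R) : R :=
  a 0 * minor4 b c d - b 0 * minor4 a c d + c 0 * minor4 a b d - d 0 * minor4 a b c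

/-- The value at `ζ` of a polynomial of degree at most three given by its coefficients. -/
def cubicEval {R : Type*} [CommRing R] (ζ : R) (v : Fin 4 → R) : R :=
  v 0 + v 1 * ζ + v 2 * ζ ^ 2 + v 3 * ζ ^ 3

lemma det4_cramer {R : Type*} [CommRing R] (a b c d p : Fin 4 → R) (j : Fin 4) :
    det4 a b c d * p j = det4 p b c d * a j + det4 a p c d * b j + det4 a b p d * c j
      + det4 a b c p * d j := by
  fin_cases j <;> simp [det4, minor4] <;> ring

lemma det4_eq_cubicEval {R : Type*} [CommRing R] (ζ : R) (a b c d : Fin 4 → R) :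
    det4 a b c d = cubicEval ζ a * minor4 b c d - cubicEval ζ b * minor4 a c d
      + cubicEval ζ c * minor4 a b d - cubicEval ζ d * minor4 a b c := by
  simp only [det4, minor4, cubicEval]; ring

lemma abs_minor4_le {a b c : Fin 4 → ℝ} {A B C : ℝ} (ha : ∀ i, |a i| ≤ A) (hb : ∀ i, |b i| ≤ B)
    (hc : ∀ i, |c i| ≤ C) : |minor4 a b c| ≤ 6 * (A * B * C) := by
  have h := fun i j => abs_mul_sub_mul_le (hb i) (hc j) (hb j) (hc i)
  unfold minor4
  refine (abs_add_le _ _).trans ?_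
  have h1 := abs_mul_sub_mul_le (ha 1) (h 2 3) (ha 2) (h 1 3)
  have h2 := mul_le_mul (ha 3) (h 1 2) (abs_nonneg _) ((abs_nonneg _).trans (ha 3))
  rw [← abs_mul] at h2
  linarith

lemma abs_det4_le {ζ : ℝ} {a b c d : Fin 4 → ℝ} {A B C D E F G H : ℝ} (ha : ∀ i, |a i| ≤ A)
    (hb : ∀ i, |b i| ≤ B) (hc : ∀ i, |c i| ≤ C) (hd : ∀ i, |d i| ≤ D)
    (hE : |cubicEval ζ a| ≤ E) (hF : |cubicEval ζ b| ≤ F) (hG : |cubicEval ζ c| ≤ G)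
    (hH : |cubicEval ζ d| ≤ H) :
    |det4 a b c d| ≤ 6 * (E * (B * C * D) + F * (A * C * D) + G * (A * B * D)
      + H * (A * B * C)) := by
  rw [det4_eq_cubicEval ζ, add_sub_assoc]
  refine (abs_add_le _ _).trans ?_
  have h1 := abs_mul_sub_mul_le hE (abs_minor4_le hb hc hd) hF (abs_minor4_le ha hc hd)
  have h2 := abs_mul_sub_mul_le hG (abs_minor4_le ha hb hd) hH (abs_minor4_le ha hb hc)
  linarith

/-- The coefficients of a quadratic polynomial, seen as a cubic. -/
def quadRow (v : Fin 3 → ℤ) : Fin 4 → ℤ := ![v 0, v 1, v 2, 0]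

/-- The coefficients of a quadratic polynomial times the variable. -/
def quadRowShift (v : Fin 3 → ℤ) : Fin 4 → ℤ := ![0, v 0, v 1, v 2]

lemma det4_quadRow (u v : Fin 3 → ℤ) :
    det4 (quadRow u) (quadRowShift u) (quadRow v) (quadRowShift v)
      = -conicForm (crossProduct u v) := by
  obtain ⟨c0, c1, c2⟩ := crossProduct_coords u v
  unfold conicForm
  rw [c0, c1, c2]
  simp [det4, minor4, quadRow, quadRowShift]
  ring

lemma cast_det4 (a b c d : Fin 4 → ℤ) :
    ((det4 a b c d : ℤ) : ℝ) = det4 (fun i => (a i : ℝ)) (fun i => (b i : ℝ)) (fun i => (c i : ℝ))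
      (fun i => (d i : ℝ)) := by
  simp [det4, minor4]

section Bounds

variable {ζ A B H E F Q : ℝ} {u v : Fin 3 → ℤ} {p : Fin 4 → ℤ}

lemma abs_quadRow_le (hu : ∀ i, |(u i : ℝ)| ≤ A) (i : Fin 4) : |(quadRow u i : ℝ)| ≤ A := by
  have := (abs_nonneg _).trans (hu 0)
  fin_cases i <;> simp [quadRow, hu, this]

lemma abs_quadRowShift_le (hu : ∀ i, |(u i : ℝ)| ≤ A) (i : Fin 4) :
    |(quadRowShift u i : ℝ)| ≤ A := by
  have := (abs_nonneg _).trans (hu 0)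
  fin_cases i <;> simp [quadRowShift, hu, this]

lemma cubicEval_quadRow (u : Fin 3 → ℤ) :
    cubicEval ζ (fun i => (quadRow u i : ℝ)) = quadEval ζ u := by
  simp [cubicEval, quadRow, quadEval]

lemma cubicEval_quadRowShift (u : Fin 3 → ℤ) :
    cubicEval ζ (fun i => (quadRowShift u i : ℝ)) = ζ * quadEval ζ u := by
  simp [cubicEval, quadRowShift, quadEval]; ring

lemma abs_cubicEval_quadRow_le (hE : |quadEval ζ u| ≤ E) :
    |cubicEval ζ (fun i => (quadRow u i : ℝ))| ≤ E := by
  rwa [cubicEval_quadRow]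

lemma abs_cubicEval_quadRowShift_le (hE : |quadEval ζ u| ≤ E) :
    |cubicEval ζ (fun i => (quadRowShift u i : ℝ))| ≤ |ζ| * E := by
  rw [cubicEval_quadRowShift, abs_mul]; gcongr

/-- Bound for the cofactors of the polynomial with larger height. -/
lemma abs_det4_high_le (hu : ∀ i, |(u i : ℝ)| ≤ A) (hv : ∀ i, |(v i : ℝ)| ≤ B)
    (hp : ∀ i, |(p i : ℝ)| ≤ H) (hE : |quadEval ζ u| ≤ E) (hF : |quadEval ζ v| ≤ F)
    (hQ : |cubicEval ζ (fun i => (p i : ℝ))| ≤ Q) :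
    |((det4 (quadRow u) (quadRowShift u) p (quadRowShift v) : ℤ) : ℝ)|
      ≤ 6 * (|ζ| + 1) * (Q * (A * A * B) + E * (A * H * B) + F * (A * A * H)) ∧
    |((det4 (quadRow u) (quadRowShift u) (quadRow v) p : ℤ) : ℝ)|
      ≤ 6 * (|ζ| + 1) * (Q * (A * A * B) + E * (A * H * B) + F * (A * A * H)) := by
  have hA := (abs_nonneg _).trans (hu 0)
  have hB := (abs_nonneg _).trans (hv 0)
  have hH := (abs_nonneg _).trans (hp 0)
  have hF0 := (abs_nonneg _).trans hF
  have hQ0 := (abs_nonneg _).trans hQ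
  have h1 : 0 ≤ |ζ| * (Q * (A * A * B)) := by positivity
  have h2 : 0 ≤ F * (A * A * H) := by positivity
  have h3 : 0 ≤ |ζ| * (F * (A * A * H)) := by positivity
  rw [cast_det4, cast_det4]
  constructor
  · refine (abs_det4_le (abs_quadRow_le hu) (abs_quadRowShift_le hu) hp (abs_quadRowShift_le hv)
      (abs_cubicEval_quadRow_le hE) (abs_cubicEval_quadRowShift_le hE) hQ
      (abs_cubicEval_quadRowShift_le hF)).trans ?_
    linarith
  · refine (abs_det4_le (abs_quadRow_le hu) (abs_quadRowShift_le hu) (abs_quadRow_le hv) hp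
      (abs_cubicEval_quadRow_le hE) (abs_cubicEval_quadRowShift_le hE)
      (abs_cubicEval_quadRow_le hF) hQ).trans ?_
    linarith

/-- Bound for the leading cofactor of the polynomial with smaller height. -/
lemma abs_det4_low_le (hu : ∀ i, |(u i : ℝ)| ≤ A) (hv : ∀ i, |(v i : ℝ)| ≤ B)
    (hp : ∀ i, |(p i : ℝ)| ≤ H) (hE : |quadEval ζ u| ≤ E) (hF : |quadEval ζ v| ≤ F)
    (hQ : |cubicEval ζ (fun i => (p i : ℝ))| ≤ Q) :
    |((det4 (quadRow u) p (quadRow v) (quadRowShift v) : ℤ) : ℝ)|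
      ≤ 6 * (|ζ| + 1) * (Q * (A * B * B) + E * (H * B * B) + F * (A * H * B)) := by
  have hA := (abs_nonneg _).trans (hu 0)
  have hB := (abs_nonneg _).trans (hv 0)
  have hH := (abs_nonneg _).trans (hp 0)
  have hE0 := (abs_nonneg _).trans hE
  have hQ0 := (abs_nonneg _).trans hQ
  have h1 : 0 ≤ |ζ| * (Q * (A * B * B)) := by positivity
  have h2 : 0 ≤ |ζ| * (E * (H * B * B)) := by positivity
  rw [cast_det4]
  refine (abs_det4_le (abs_quadRow_le hu) hp (abs_quadRow_le hv) (abs_quadRowShift_le hv)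
    (abs_cubicEval_quadRow_le hE) hQ (abs_cubicEval_quadRow_le hF)
    (abs_cubicEval_quadRowShift_le hF)).trans ?_
  linarith

/-- Bound for the value at `ζ` of the cofactor of the polynomial with smaller height. -/
lemma abs_det4_low_eval_le (hu : ∀ i, |(u i : ℝ)| ≤ A) (hv : ∀ i, |(v i : ℝ)| ≤ B)
    (hp : ∀ i, |(p i : ℝ)| ≤ H) (hF : |quadEval ζ v| ≤ F)
    (hQ : |cubicEval ζ (fun i => (p i : ℝ))| ≤ Q) :
    |((det4 p (quadRowShift u) (quadRow v) (quadRowShift v) : ℤ) : ℝ)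
        + (det4 (quadRow u) p (quadRow v) (quadRowShift v) : ℤ) * ζ|
      ≤ 6 * (|ζ| + 1) ^ 2 * (Q * (A * B * B) + F * (A * H * B)) := by
  have hA := (abs_nonneg _).trans (hu 0)
  have hB := (abs_nonneg _).trans (hv 0)
  have hQ0 := (abs_nonneg _).trans hQ
  have hid : ((det4 p (quadRowShift u) (quadRow v) (quadRowShift v) : ℤ) : ℝ)
        + (det4 (quadRow u) p (quadRow v) (quadRowShift v) : ℤ) * ζ
      = det4 (fun i => (p i : ℝ)) (fun i => quadRowShift u i - ζ * quadRow u i)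
        (fun i => (quadRow v i : ℝ)) (fun i => (quadRowShift v i : ℝ)) := by
    rw [cast_det4, cast_det4]
    simp only [det4, minor4]; ring
  have hw : ∀ i, |(quadRowShift u i : ℝ) - ζ * quadRow u i| ≤ (|ζ| + 1) * A := fun i => by
    refine (abs_sub _ _).trans ?_
    rw [abs_mul]
    have := mul_le_mul_of_nonneg_left (abs_quadRow_le hu i) (abs_nonneg ζ)
    linarith [abs_quadRowShift_le hu i]
  have h0 : |cubicEval ζ (fun i => (quadRowShift u i : ℝ) - ζ * quadRow u i)| ≤ 0 := by
    have : cubicEval ζ (fun i => (quadRowShift u i : ℝ) - ζ * quadRow u i)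
        = cubicEval ζ (fun i => (quadRowShift u i : ℝ))
          - ζ * cubicEval ζ (fun i => (quadRow u i : ℝ)) := by
      simp only [cubicEval]; ring
    rw [this, cubicEval_quadRow, cubicEval_quadRowShift, sub_self, abs_zero]
  have h1 : 0 ≤ |ζ| * (|ζ| + 1) * (Q * (A * B * B)) := by positivity
  rw [hid]
  refine (abs_det4_le hp hw (abs_quadRow_le hv) (abs_quadRowShift_le hv) hQ h0
    (abs_cubicEval_quadRow_le hF) (abs_cubicEval_quadRowShift_le hF)).trans ?_
  linarith

end Bounds

lemma Irreducible.mul_ne_of_natDegree_lt {P S T : ℤ[X]} (hP : Irreducible P) {R : ℤ} (hR : R ≠ 0)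
    (hS : S.natDegree < P.natDegree) (hT : T.natDegree < P.natDegree) : C R * P ≠ S * T := by
  intro h
  have h0 : S * T ≠ 0 := h ▸ mul_ne_zero (C_ne_zero.mpr hR) hP.ne_zero
  rcases hP.prime.dvd_or_dvd (h ▸ dvd_mul_left P (C R)) with h1 | h1
  · exact (natDegree_le_of_dvd h1 (left_ne_zero_of_mul h0)).not_gt hS
  · exact (natDegree_le_of_dvd h1 (right_ne_zero_of_mul h0)).not_gt hT

/-- The coefficients of a polynomial up to degree three. -/
def coeffRow (P : ℤ[X]) : Fin 4 → ℤ := fun i => P.coeff i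

lemma pev_eq_cubicEval {ζ : ℝ} {P : ℤ[X]} (h : P.natDegree = 3) :
    pev ζ P = cubicEval ζ (fun i => (coeffRow P i : ℝ)) := by
  rw [pev, aeval_eq_sum_range' (n := 4) (by omega)]
  simp [Finset.sum_range_succ, cubicEval, coeffRow]

lemma natDegree_linear_lt (s t : ℤ) : (C s + C t * X : ℤ[X]).natDegree < 3 := by
  have : (C s + C t * X : ℤ[X]).natDegree ≤ 1 := by compute_degree
  omega

lemma natDegree_quadratic_lt (v : Fin 3 → ℤ) :
    (C (v 0) + C (v 1) * X + C (v 2) * X ^ 2 : ℤ[X]).natDegree < 3 := by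
  have : (C (v 0) + C (v 1) * X + C (v 2) * X ^ 2 : ℤ[X]).natDegree ≤ 2 := by compute_degree
  omega

lemma eq_cubic_of_natDegree {P : ℤ[X]} (h : P.natDegree = 3) :
    P = C (coeffRow P 0) + C (coeffRow P 1) * X + C (coeffRow P 2) * X ^ 2
      + C (coeffRow P 3) * X ^ 3 := by
  conv_lhs => rw [P.as_sum_range_C_mul_X_pow' (n := 4) (by omega)]
  simp [Finset.sum_range_succ, coeffRow]

lemma C_mul_eq_of_natDegree_eq_three {P : ℤ[X]} (h : P.natDegree = 3) (u v : Fin 3 → ℤ) :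
    C (det4 (quadRow u) (quadRowShift u) (quadRow v) (quadRowShift v)) * P
      = (C (det4 (coeffRow P) (quadRowShift u) (quadRow v) (quadRowShift v))
          + C (det4 (quadRow u) (coeffRow P) (quadRow v) (quadRowShift v)) * X)
          * (C (u 0) + C (u 1) * X + C (u 2) * X ^ 2)
        + (C (det4 (quadRow u) (quadRowShift u) (coeffRow P) (quadRowShift v))
          + C (det4 (quadRow u) (quadRowShift u) (quadRow v) (coeffRow P)) * X)
          * (C (v 0) + C (v 1) * X + C (v 2) * X ^ 2) := by
  have hP := eq_cubic_of_natDegree h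
  have key := fun j => congrArg (C : ℤ → ℤ[X])
    (det4_cramer (quadRow u) (quadRowShift u) (quadRow v) (quadRowShift v) (coeffRow P) j)
  have k0 := key 0
  have k1 := key 1
  have k2 := key 2
  have k3 := key 3
  set p := coeffRow P
  rw [hP]
  simp only [C_mul, C_add] at k0 k1 k2 k3
  generalize det4 (quadRow u) (quadRowShift u) (quadRow v) (quadRowShift v) = R at *
  generalize det4 p (quadRowShift u) (quadRow v) (quadRowShift v) = x at *
  generalize det4 (quadRow u) p (quadRow v) (quadRowShift v) = y at *
  generalize det4 (quadRow u) (quadRowShift u) p (quadRowShift v) = z at *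
  generalize det4 (quadRow u) (quadRowShift u) (quadRow v) p = w at *
  simp [quadRow, quadRowShift, -eq_intCast] at k0 k1 k2 k3
  linear_combination k0 + X * k1 + X ^ 2 * k2 + X ^ 3 * k3

lemma one_le_polyH {P : ℤ[X]} (hP : P ≠ 0) : 1 ≤ polyH P := by
  refine le_trans ?_ (abs_coeff_le_polyH P P.natDegree)
  exact one_le_abs_intCast (leadingCoeff_ne_zero.mpr hP)

lemma abs_pev_le_of_root {ζ α : ℝ} {P : ℤ[X]} (h : P.natDegree = 3) (hα : pev α P = 0)
    (hζα : |ζ - α| ≤ 1) : |pev ζ P| ≤ 6 * (|ζ| + 1) ^ 2 * (polyH P * |ζ - α|) := by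
  have hid : pev ζ P = (ζ - α) * (P.coeff 1 + P.coeff 2 * (ζ + α)
      + P.coeff 3 * (ζ ^ 2 + ζ * α + α ^ 2)) := by
    rw [← sub_zero (pev ζ P), ← hα, pev_eq_cubicEval h, pev_eq_cubicEval h]
    simp only [cubicEval, coeffRow, Fin.isValue, Fin.coe_ofNat_eq_mod]
    norm_num
    ring
  set Z := |ζ| + 1 with hZ
  have hZ1 : 1 ≤ Z := by rw [hZ]; linarith [abs_nonneg ζ]
  have hζZ : |ζ| ≤ Z := by rw [hZ]; linarith
  have hαZ : |α| ≤ Z := by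
    have : α = ζ - (ζ - α) := by ring
    rw [this]
    exact (abs_sub _ _).trans (by rw [hZ]; linarith)
  have hc := abs_coeff_le_polyH P
  have h2 : |ζ + α| ≤ 2 * Z := (abs_add_le _ _).trans (by linarith)
  have h3 : |ζ ^ 2 + ζ * α + α ^ 2| ≤ 3 * Z ^ 2 := by
    refine (abs_add_three _ _ _).trans ?_
    rw [abs_pow, abs_mul, abs_pow]
    have := pow_le_pow_left₀ (abs_nonneg ζ) hζZ 2
    have := pow_le_pow_left₀ (abs_nonneg α) hαZ 2
    have := mul_le_mul hζZ hαZ (abs_nonneg α) (by linarith)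
    linarith
  have hH : 0 ≤ polyH P := (abs_nonneg _).trans (hc 0)
  have h4 : |(P.coeff 1 : ℝ) + P.coeff 2 * (ζ + α) + P.coeff 3 * (ζ ^ 2 + ζ * α + α ^ 2)|
      ≤ 6 * Z ^ 2 * polyH P := by
    refine (abs_add_three _ _ _).trans ?_
    rw [abs_mul, abs_mul]
    have e2 := mul_le_mul (hc 2) h2 (abs_nonneg _) hH
    have e3 := mul_le_mul (hc 3) h3 (abs_nonneg _) hH
    have e4 : 1 * polyH P ≤ Z ^ 2 * polyH P := by
      gcongr; exact one_le_pow₀ hZ1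
    have e5 : Z * polyH P ≤ Z ^ 2 * polyH P := by
      gcongr; exact le_self_pow₀ hZ1 two_ne_zero
    linarith [hc 1]
  rw [hid, abs_mul]
  refine (mul_le_mul_of_nonneg_left h4 (abs_nonneg _)).trans_eq (by ring)

/-- If the value at `ζ` of an integral linear polynomial is too small in terms of its leading
coefficient, the polynomial vanishes. -/
lemma LinearLower.exists_neg_le {ζ w : ℝ} (h : LinearLower ζ w) (hw : 0 ≤ w) :
    ∃ C : ℝ, ∀ (s t : ℤ) (K x y : ℝ), 1 ≤ K → |(t : ℝ)| ≤ K * exp x →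
      |(s : ℝ) + t * ζ| ≤ K * exp y → (s ≠ 0 ∨ t ≠ 0) →
      -log K ≤ y ∨ -(C + (1 + w) * log K) ≤ w * x + y := by
  obtain ⟨C, hC⟩ := h
  refine ⟨C, fun s t K x y hK ht hs hst => ?_⟩
  have hKpos : 0 < K := by linarith
  rcases eq_or_ne t 0 with rfl | ht0
  · left
    refine neg_log_le_of_one_le_mul_exp hKpos (le_trans ?_ hs)
    simpa using one_le_abs_intCast (hst.resolve_right (by simp))
  · right
    have h1 := hC (-s) t ht0
    have h2 : (t : ℝ) * ζ - (-s : ℤ) = s + t * ζ := by push_cast; ring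
    rw [h2] at h1
    replace h1 := h1.trans hs
    have h3 : log |(t : ℝ)| ≤ log K + x := by
      rw [← exp_le_exp, exp_log_abs_intCast ht0, exp_add, exp_log hKpos]; exact ht
    rw [← exp_log hKpos, ← exp_add, exp_le_exp] at h1
    have h4 := mul_le_mul_of_nonneg_left h3 hw
    linarith

lemma HasExtremalPairs.eventually_lt_abs_pev {ζ ε : ℝ} (hP : HasExtremalPairs ζ)
    (hL : ∀ δ > 0, LinearLower ζ (1 + δ)) (hε : 0 < ε) {K : ℝ} (hK : 1 ≤ K) :
    ∃ h₀ : ℝ, ∀ P : ℤ[X], Irreducible P → P.natDegree = 3 → h₀ ≤ log (polyH P) →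
      K * exp (-((3 + ε) * log (polyH P))) < |pev ζ P| := by
  obtain ⟨hg1, hg2⟩ := goldenRatio_bounds
  set d : ℝ := min (ε / 100) 0.001 with hd
  have hd0 : 0 < d := by positivity
  have hd1 : d ≤ 0.001 := min_le_right _ _
  have hdε : 100 * d ≤ ε := by have := min_le_left (ε / 100) 0.001; linarith
  obtain ⟨x₀, hx₀⟩ := hP d hd0
  obtain ⟨c, hc⟩ := (hL d hd0).exists_neg_le (by linarith)
  set M : ℝ := 6 * (|ζ| + 1) ^ 2 * (3 * K) with hM
  have hZ : 1 ≤ |ζ| + 1 := by linarith [abs_nonneg ζ]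
  have hZ2 : |ζ| + 1 ≤ (|ζ| + 1) ^ 2 := le_self_pow₀ hZ two_ne_zero
  have hM1 : 1 ≤ M := by rw [hM]; linarith [mul_le_mul (hZ.trans hZ2) hK zero_le_one (by positivity)]
  have hMpos : 0 < M := by linarith
  have hK0 : 0 ≤ K := by linarith
  have hZ' : 6 * (|ζ| + 1) ≤ 6 * (|ζ| + 1) ^ 2 := by linarith
  have hlogM : 0 ≤ log M := log_nonneg hM1
  refine ⟨max (x₀ / 0.63) ((|c| + 3 * log M + 1) / (0.63 * d)), fun P hirr hdeg hh => ?_⟩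
  by_contra! hle
  set h := log (polyH P) with hlog
  have hH : polyH P = exp h :=
    (exp_log (by linarith [one_le_polyH hirr.ne_zero])).symm
  have hh1 : x₀ / 0.63 ≤ h := (le_max_left _ _).trans hh
  have hh2 : (|c| + 3 * log M + 1) / (0.63 * d) ≤ h := (le_max_right _ _).trans hh
  rw [div_le_iff₀ (by positivity)] at hh1 hh2
  obtain ⟨u, v, a, b, hxb, hbx, hab, hu, hv, hE, hF, hD⟩ := hx₀ (0.63 * h) (by linarith)
  have hc0 := abs_nonneg c
  have hc1 := le_abs_self c
  have hhpos : 0 ≤ h := by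
    refine nonneg_of_mul_nonneg_left (b := 0.63 * d) ?_ (by positivity)
    linarith
  have hb0 : 0 ≤ b := by linarith
  have hdb : |c| + 3 * log M + 1 ≤ d * b := by
    have := mul_le_mul_of_nonneg_left hxb hd0.le
    linarith
  have hbh : b ≤ 1.0201 * h := by
    refine hbx.trans ?_
    rw [← mul_assoc]
    gcongr
    linarith
  have ha := (abs_le.mp hab).2
  have ex : ∀ s t r w y : ℝ, s + (t + r + w) ≤ y → exp s * (exp t * exp r * exp w) ≤ exp y :=
    fun s t r w y hy => by
      rw [← exp_add, ← exp_add, ← exp_add]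
      exact exp_le_exp.mpr hy
  have exK : ∀ y, exp y ≤ K * exp y := fun y => le_mul_of_one_le_left (exp_pos y).le hK
  have hp : ∀ i, |(coeffRow P i : ℝ)| ≤ exp h := fun i => hH ▸ abs_coeff_le_polyH P i
  rw [pev_eq_cubicEval hdeg] at hle
  have hid := C_mul_eq_of_natDegree_eq_three hdeg u v
  rw [det4_quadRow] at hid
  have hR := neg_ne_zero.mpr hD
  have hεh : 0 ≤ ε * h := by positivity
  have hdb0 : 0 ≤ d * b := by positivity
  have hgb1 := mul_le_mul_of_nonneg_right hg1.le hb0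
  have hgb2 := mul_le_mul_of_nonneg_right hg2.le hb0
  have hdb1 := mul_le_mul_of_nonneg_right hd1 hb0
  have hdh : 100 * d * h ≤ ε * h := by gcongr
  have hdhb := mul_le_mul_of_nonneg_left hxb hd0.le
  have hdbh := mul_le_mul_of_nonneg_left hbh hd0.le
  rcases le_total h ((1 - 3 * d) * b) with hcase | hcase
  · have small : ∀ n : ℤ, |(n : ℝ)| ≤ 6 * (|ζ| + 1) * (K * exp (-((3 + ε) * h))
        * (exp a * exp a * exp b) + exp (-((goldenRatio + 1 - d) * b)) * (exp a * exp h * exp b)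
        + exp (-((2 * goldenRatio + 1 - d) * b)) * (exp a * exp a * exp h)) → n = 0 := by
      intro n hn
      by_contra hn0
      have e1 := ex (-((3 + ε) * h)) a a b (-(d * b)) (by linarith)
      have e2 := ex (-((goldenRatio + 1 - d) * b)) a h b (-(d * b)) (by linarith)
      have e3 := ex (-((2 * goldenRatio + 1 - d) * b)) a a h (-(d * b)) (by linarith)
      have e4 : |(n : ℝ)| ≤ M * exp (-(d * b)) := by
        refine hn.trans ?_
        calc _ ≤ 6 * (|ζ| + 1) ^ 2 * (K * exp (-(d * b)) + K * exp (-(d * b))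
              + K * exp (-(d * b))) := by
              rw [mul_assoc K]
              refine mul_le_mul hZ' (add_le_add (add_le_add (mul_le_mul_of_nonneg_left e1 hK0)
                (e2.trans (exK _))) (e3.trans (exK _))) (by positivity) (by positivity)
          _ = _ := by rw [hM]; ring
      have := neg_log_le_of_one_le_mul_exp hMpos ((one_le_abs_intCast hn0).trans e4)
      linarith
    obtain ⟨b0, b1⟩ := abs_det4_high_le hu hv hp hE hF hle
    rw [small _ b0, small _ b1, C_0, zero_mul, add_zero, zero_mul, add_zero] at hid
    refine hirr.mul_ne_of_natDegree_lt hR ?_ ?_ hid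
    · rw [hdeg]; exact natDegree_linear_lt _ _
    · rw [hdeg]; exact natDegree_quadratic_lt _
  · have a1 := abs_det4_low_le hu hv hp hE hF hle
    have a2 := abs_det4_low_eval_le hu hv hp hF hle
    set x := h - (goldenRatio - 1 - d) * b with hx
    set y := max ((goldenRatio + 1 + d) * b - (3 + ε) * h) (h - (goldenRatio + 1 - 2 * d) * b)
      with hy
    replace a1 : |((det4 (quadRow u) (coeffRow P) (quadRow v) (quadRowShift v) : ℤ) : ℝ)|
        ≤ M * exp x := by
      have e1 := ex (-((3 + ε) * h)) a b b x (by linarith)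
      have e2 := ex (-((goldenRatio + 1 - d) * b)) h b b x (by rw [hx]; linarith)
      have e3 := ex (-((2 * goldenRatio + 1 - d) * b)) a h b x (by linarith)
      refine a1.trans ?_
      calc _ ≤ 6 * (|ζ| + 1) ^ 2 * (K * exp x + K * exp x + K * exp x) := by
            rw [mul_assoc K]
            refine mul_le_mul hZ' (add_le_add (add_le_add (mul_le_mul_of_nonneg_left e1 hK0)
              (e2.trans (exK _))) (e3.trans (exK _))) (by positivity) (by positivity)
        _ = _ := by rw [hM]; ring
    replace a2 : |((det4 (coeffRow P) (quadRowShift u) (quadRow v) (quadRowShift v) : ℤ) : ℝ)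
        + (det4 (quadRow u) (coeffRow P) (quadRow v) (quadRowShift v) : ℤ) * ζ|
        ≤ M * exp y := by
      have e1 := ex (-((3 + ε) * h)) a b b y (le_max_of_le_left (by linarith))
      have e2 := ex (-((2 * goldenRatio + 1 - d) * b)) a h b y (le_max_of_le_right (by linarith))
      refine a2.trans ?_
      calc _ ≤ 6 * (|ζ| + 1) ^ 2 * (K * exp y + K * exp y) := by
            rw [mul_assoc K]
            exact mul_le_mul_of_nonneg_left (add_le_add (mul_le_mul_of_nonneg_left e1 hK0)
              (e2.trans (exK _))) (by positivity)
        _ ≤ 6 * (|ζ| + 1) ^ 2 * (K * exp y + K * exp y + K * exp y) := by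
            gcongr
            exact le_add_of_nonneg_right (by positivity)
        _ = _ := by rw [hM]; ring
    have hzero : det4 (coeffRow P) (quadRowShift u) (quadRow v) (quadRowShift v) = 0 ∧
        det4 (quadRow u) (coeffRow P) (quadRow v) (quadRowShift v) = 0 := by
      by_contra hne
      rw [not_and_or] at hne
      have hy1 : y ≤ -(d * b) := max_le (by linarith) (by linarith)
      have hy2 : (1 + d) * x + y ≤ -(3 * (d * b)) := by
        have hdx : d * x ≤ d * h := by
          gcongr
          linarith
        rw [← le_sub_iff_add_le']
        exact max_le (by linarith) (by linarith)
      rcases hc _ _ M x y hM1 a1 a2 hne with h1 | h1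
      · linarith
      · have := mul_le_mul_of_nonneg_right hd1 hlogM
        linarith
    rw [hzero.1, hzero.2, C_0, zero_mul, add_zero, zero_mul, zero_add] at hid
    refine hirr.mul_ne_of_natDegree_lt hR ?_ ?_ hid
    · rw [hdeg]; exact natDegree_linear_lt _ _
    · rw [hdeg]; exact natDegree_quadratic_lt _

lemma finite_setOf_root_polyH_le (M : ℝ) :
    {α : ℝ | ∃ P : ℤ[X], P ≠ 0 ∧ P.natDegree = 3 ∧ pev α P = 0 ∧ polyH P ≤ M}.Finite := by
  let toPoly : (Fin 4 → ℤ) → ℤ[X] := fun v => C (v 0) + C (v 1) * X + C (v 2) * X ^ 2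
    + C (v 3) * X ^ 3
  have hfin : (Set.Icc (fun _ => -⌈M⌉) (fun _ => ⌈M⌉) : Set (Fin 4 → ℤ)).Finite :=
    Set.finite_Icc _ _
  refine (hfin.biUnion fun v _ => (toPoly v).rootSet_finite ℝ).subset ?_
  rintro α ⟨P, hP0, hdeg, hα, hM⟩
  have hc : ∀ i, |P.coeff i| ≤ ⌈M⌉ := fun i => by
    have := ((abs_coeff_le_polyH P i).trans hM).trans (Int.le_ceil M)
    exact_mod_cast this
  have hP : toPoly (coeffRow P) = P := (eq_cubic_of_natDegree hdeg).symm
  simp only [Set.mem_iUnion]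
  refine ⟨coeffRow P, ⟨fun i => (abs_le.mp (hc i)).1, fun i => (abs_le.mp (hc i)).2⟩, ?_⟩
  rw [hP, mem_rootSet]
  exact ⟨hP0, hα⟩

theorem extremal_cubic_alg_finite (ζ : ℝ) (hζ : IsExtremal ζ) (ε : ℝ) (hε : 0 < ε) :
    {α : ℝ | ∃ P : Polynomial ℤ, Irreducible P ∧ P.natDegree = 3 ∧ pev α P = 0 ∧
      |ζ - α| ≤ polyH P ^ (-4 - ε)}.Finite := by
  have hirr : Irrational ζ := hζ.1.irrational
  have hu := hζ.uniformQuad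
  have hP := hu.hasExtremalPairs hirr
  have hL : ∀ δ > 0, LinearLower ζ (1 + δ) := fun δ hδ =>
    hP.linearLower hirr (hu.linearLower hirr) hδ
  set K : ℝ := 6 * (|ζ| + 1) ^ 2 with hK
  have hK1 : 1 ≤ K := by
    have : 1 ≤ (|ζ| + 1) ^ 2 := one_le_pow₀ (by linarith [abs_nonneg ζ])
    linarith
  obtain ⟨h₀, hh₀⟩ := hP.eventually_lt_abs_pev hL hε hK1
  refine (finite_setOf_root_polyH_le (exp h₀)).subset ?_
  rintro α ⟨P, hirrP, hdeg, hα, hζα⟩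
  refine ⟨P, hirrP.ne_zero, hdeg, hα, ?_⟩
  by_contra! hlt
  have hH1 := one_le_polyH hirrP.ne_zero
  have hHpos : 0 < polyH P := by linarith
  refine (hh₀ P hirrP hdeg ((le_log_iff_exp_le hHpos).mpr hlt.le)).not_ge ?_
  have h1 : |ζ - α| ≤ 1 := hζα.trans (rpow_le_one_of_one_le_of_nonpos hH1 (by linarith))
  refine (abs_pev_le_of_root hdeg hα h1).trans ?_
  gcongr
  calc polyH P * |ζ - α| ≤ polyH P * polyH P ^ (-4 - ε) := by gcongr
    _ = exp (-((3 + ε) * log (polyH P))) := by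
      rw [rpow_def_of_pos hHpos]
      nth_rewrite 1 [← exp_log hHpos]
      rw [← exp_add]; ring_nf
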